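/- arXiv:2005.05291 — 3 statements merged into one kernel-verified Lean document; each statement's English description precedes it below -/
import Mathlib

section
/- Let k ≥ 3 and set d = k−2 and δ = 5/9. For every μ > 0 there exists γ_0 > 0 such that for every 0 < γ ≤ γ_0 there exists α_0 > 0 such that for every 0 < α ≤ α_0 there exists t_0 such that for every t ≥ t_0: every k-graph R on t vertices with α-perturbed minimum relative (k−2)-degree at least 5/9 + μ and no isolated vertices admits a (γ, 5/9)-Hamilton (k−2)-vicinity. (Equivalently, the Hamilton vicinity threshold satisfies hv_{k−2}(k) ≤ 5/9.) -/
open Finset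

variable {A : Type*} [DecidableEq A]

/-- The set of vertices occupying positions `i, …, i+k-1` of the walk `w`. -/
def walkEdgeAt (k : ℕ) (w : List A) (i : ℕ) : Finset A :=
  ((w.drop i).take k).toFinset

/-- `w` is a tight walk in the `k`-graph with edge set `E`: it has at least `k`
vertices and every `k` consecutive vertices form an edge of `E`. -/
def IsTightWalk (k : ℕ) (E : Finset (Finset A)) (w : List A) : Prop :=
  k ≤ w.length ∧ ∀ i, i + k ≤ w.length → walkEdgeAt k w i ∈ E

/-- The edge `e` appears on the walk `w` (as `k` consecutive vertices). -/
def EdgeOnWalk (k : ℕ) (w : List A) (e : Finset A) : Prop :=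
  ∃ i, i + k ≤ w.length ∧ walkEdgeAt k w i = e

/-- A `k`-uniform edge set is tightly connected if any two of its edges lie on a
common tight walk all of whose edges belong to it. -/
def TightlyConnected (k : ℕ) (E : Finset (Finset A)) : Prop :=
  ∀ e₁ ∈ E, ∀ e₂ ∈ E, ∃ w : List A, IsTightWalk k E w ∧ EdgeOnWalk k w e₁ ∧ EdgeOnWalk k w e₂

/-- `w` is a closed tight walk: every cyclic interval of `k` consecutive vertices
forms an edge of `E`.  Its length is `w.length`. -/
def IsClosedTightWalk (k : ℕ) (E : Finset (Finset A)) (w : List A) : Prop :=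
  k ≤ w.length ∧ ∀ i < w.length, ((w.rotate i).take k).toFinset ∈ E

/-- A tight Hamilton cycle: a cyclic ordering of all the vertices in which every `k`
cyclically consecutive vertices form an edge. -/
def HasTightHamCycle (k : ℕ) (V : Finset A) (E : Finset (Finset A)) : Prop :=
  ∃ w : List A, w.Nodup ∧ w.toFinset = V ∧ IsClosedTightWalk k E w

/-- The `j`-th shadow: all `j`-element sets contained in some edge. -/
def shadow (j : ℕ) (E : Finset (Finset A)) : Finset (Finset A) :=
  E.biUnion fun e => e.powersetCard j

/-- The link graph of `S`: the `(k-d)`-graph whose edges are `e \ S` for edges `e ⊇ S`. -/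
def link (S : Finset A) (E : Finset (Finset A)) : Finset (Finset A) :=
  (E.filter fun e => S ⊆ e).image fun e => e \ S

/-- `E` has a fractional matching of size at least `m`. -/
def HasFracMatching (E : Finset (Finset A)) (m : ℝ) : Prop :=
  ∃ w : Finset A → ℝ,
    (∀ e ∈ E, 0 ≤ w e ∧ w e ≤ 1) ∧
    (∀ v : A, ∑ e ∈ E.filter (fun e' => v ∈ e'), w e ≤ 1) ∧
    m ≤ ∑ e ∈ E, w e

/-- `E` has a `b`-fractional matching of size at least `m` (vertex constraints on `V`). -/
def HasBFracMatching (V : Finset A) (E : Finset (Finset A)) (b : A → ℝ) (m : ℝ) : Prop :=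
  ∃ w : Finset A → ℝ,
    (∀ e ∈ E, 0 ≤ w e ∧ w e ≤ 1) ∧
    (∀ v ∈ V, ∑ e ∈ E.filter (fun e' => v ∈ e'), w e ≤ b v) ∧
    m ≤ ∑ e ∈ E, w e

/-- `γ`-robustly matchable: every vertex weighting with values in `[1-γ,1]` is realised
exactly by an edge weighting with values in `[0,1]`. -/
def RobustlyMatchable (γ : ℝ) (V : Finset A) (E : Finset (Finset A)) : Prop :=
  ∀ b : A → ℝ, (∀ v ∈ V, 1 - γ ≤ b v ∧ b v ≤ 1) →
    ∃ w : Finset A → ℝ, (∀ e ∈ E, 0 ≤ w e ∧ w e ≤ 1) ∧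
      ∀ v ∈ V, ∑ e ∈ E.filter (fun e' => v ∈ e'), w e = b v

/-- A switcher: an edge `e` with a central vertex `a` such that for every `b ∈ e`
there is `c ∉ e` with `(e ∪ {c}) \ {a}` and `(e ∪ {c}) \ {b}` both edges. -/
def HasSwitcher (C : Finset (Finset A)) : Prop :=
  ∃ e ∈ C, ∃ a ∈ e, ∀ b ∈ e, ∃ c, c ∉ e ∧
    insert c (e.erase a) ∈ C ∧ insert c (e.erase b) ∈ C

/-- An arc for the `d`-vicinity `C` of the `k`-graph with edge set `E`: a tuple of
`k+1` distinct vertices `v₁, …, v_{k+1}` with `{v₁,…,v_d} ∈ ∂_d`,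
`{v_{d+1},…,v_k} ∈ C {v₁,…,v_d}`, `{v₂,…,v_{d+1}} ∈ ∂_d` and
`{v_{d+2},…,v_{k+1}} ∈ C {v₂,…,v_{d+1}}`. -/
def HasArc (k d : ℕ) (E : Finset (Finset A)) (C : Finset A → Finset (Finset A)) : Prop :=
  ∃ l : List A, l.length = k + 1 ∧ l.Nodup ∧
    (l.take d).toFinset ∈ shadow d E ∧
    ((l.drop d).take (k - d)).toFinset ∈ C ((l.take d).toFinset) ∧
    ((l.drop 1).take d).toFinset ∈ shadow d E ∧
    (l.drop (d + 1)).toFinset ∈ C (((l.drop 1).take d).toFinset)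

/-- The `k`-graph generated by a `d`-vicinity: all sets `B ∪ S` with `S ∈ ∂_d(E)`
and `B ∈ C S`. -/
def generatedEdges (d : ℕ) (E : Finset (Finset A)) (C : Finset A → Finset (Finset A)) :
    Finset (Finset A) :=
  (shadow d E).biUnion fun S => (C S).image fun B => B ∪ S

/-- `α`-perturbed minimum relative `d`-degree at least `δ` for a `k`-graph on vertex
set `V` with edge set `E`. -/
def PerturbedDegLB (k d : ℕ) (a δ : ℝ) (V : Finset A) (E : Finset (Finset A)) : Prop :=
  ∀ j : ℕ, 1 ≤ j → j ≤ d →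
    (∀ S ∈ shadow j E,
      δ * (((V.card - j).choose (k - j) : ℕ) : ℝ) ≤ ((E.filter fun e => S ⊆ e).card : ℝ)) ∧
    ((((V.powersetCard j).filter fun S => S ∉ shadow j E).card : ℝ)
        ≤ a * ((V.card.choose j : ℕ) : ℝ)) ∧
    (∀ T : Finset A, (T ∈ shadow (j - 1) E ∨ (j = 1 ∧ T = ∅)) →
      ((((V.powersetCard j).filter fun S => T ⊆ S ∧ S ∉ shadow j E).card : ℝ)
        < a * ((V.card : ℝ) - (j : ℝ) + 1)))

/-- A `(γ, δ)`-Hamilton `d`-vicinity of a `k`-graph on `t = V.card` vertices. -/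
def IsHamVicinity (k d : ℕ) (γ δ : ℝ) (V : Finset A) (E : Finset (Finset A))
    (C : Finset A → Finset (Finset A)) : Prop :=
  (∀ S ∈ shadow d E, C S ⊆ link S E) ∧
  (∀ S ∈ shadow d E, TightlyConnected (k - d) (C S)) ∧
  (∀ S ∈ shadow d E, ∀ S' ∈ shadow d E, (C S ∩ C S').Nonempty) ∧
  (∀ S ∈ shadow d E, HasSwitcher (C S)) ∧
  HasArc k d E C ∧
  (∀ S ∈ shadow d E, HasFracMatching (C S) ((1 / (k : ℝ) + γ) * (V.card : ℝ))) ∧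
  (∀ S ∈ shadow d E, (1 - δ + γ) * ((V.card.choose (k - d) : ℕ) : ℝ) ≤ ((C S).card : ℝ))

/-- An `(a, γ, δ)`-Hamilton framework: a subgraph on vertex set `VH` with edge set `EH`
of a `k`-graph on vertex set `VR`, satisfying (F1)–(F5). -/
def IsHamFramework (k : ℕ) (a γ δ : ℝ) (VR VH : Finset A) (EH : Finset (Finset A)) : Prop :=
  (1 - a) * (VR.card : ℝ) ≤ (VH.card : ℝ) ∧
  TightlyConnected k EH ∧
  (∃ w : List A, IsClosedTightWalk k EH w ∧ w.length % k = 1 % k) ∧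
  RobustlyMatchable γ VH EH ∧
  (∀ v ∈ VH, (1 - δ + γ) * (((VH.card - 1).choose (k - 1) : ℕ) : ℝ)
      ≤ ((EH.filter fun e => v ∈ e).card : ℝ))

/-- A tight component: an edge-maximal tightly connected subgraph. -/
def IsTightComponent (k : ℕ) (E C : Finset (Finset A)) : Prop :=
  C ⊆ E ∧ TightlyConnected k C ∧
    ∀ C' : Finset (Finset A), C ⊆ C' → C' ⊆ E → TightlyConnected k C' → C' = C

/-- `δ` has the `(k,d)`-Hamilton-cycle property. -/
def HamCycleProp (k d : ℕ) (δ : ℝ) : Prop :=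
  ∀ μ : ℝ, 0 < μ → ∃ n₀ : ℕ, ∀ (B : Type) [DecidableEq B],
    ∀ (V : Finset B) (E : Finset (Finset B)),
      n₀ ≤ V.card → (∀ e ∈ E, e ⊆ V ∧ e.card = k) →
      (∀ S ⊆ V, S.card = d →
        (δ + μ) * (((V.card - d).choose (k - d) : ℕ) : ℝ)
          ≤ ((E.filter fun e => S ⊆ e).card : ℝ)) →
      HasTightHamCycle k V E

/-- `δ` has the `(k,d)`-Hamilton-framework property. -/
def HamFrameworkProp (k d : ℕ) (δ : ℝ) : Prop :=
  ∀ μ : ℝ, 0 < μ → ∃ γ₀ : ℝ, 0 < γ₀ ∧ ∀ γ : ℝ, 0 < γ → γ ≤ γ₀ →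
    ∃ α₀ : ℝ, 0 < α₀ ∧ ∀ a : ℝ, 0 < a → a ≤ α₀ →
      ∃ ε₀ : ℝ, 0 < ε₀ ∧ ∀ ε : ℝ, 0 < ε → ε ≤ ε₀ →
        ∃ t₀ : ℕ, ∀ t : ℕ, t₀ ≤ t →
          ∀ (B : Type) [DecidableEq B], ∀ (VR : Finset B) (ER : Finset (Finset B)),
            VR.card = t → (∀ e ∈ ER, e ⊆ VR ∧ e.card = k) →
            (∀ S ⊆ VR, S.card = d →
              (δ + μ) * (((t - d).choose (k - d) : ℕ) : ℝ)
                ≤ ((ER.filter fun e => S ⊆ e).card : ℝ)) →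
            ∀ I : Finset (Finset B), I ⊆ ER → (I.card : ℝ) ≤ ε * ((t.choose k : ℕ) : ℝ) →
              ∃ (VH : Finset B) (EH : Finset (Finset B)),
                VH ⊆ VR ∧ EH ⊆ ER ∧ (∀ e ∈ EH, e ⊆ VH) ∧ (∀ e ∈ EH, e ∉ I) ∧
                IsHamFramework k a γ δ VR VH EH

/-- `δ` has the `(k,d)`-Hamilton-vicinity property. -/
def HamVicinityProp (k d : ℕ) (δ : ℝ) : Prop :=
  ∀ μ : ℝ, 0 < μ → ∃ γ₀ : ℝ, 0 < γ₀ ∧ ∀ γ : ℝ, 0 < γ → γ ≤ γ₀ →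
    ∃ α₀ : ℝ, 0 < α₀ ∧ ∀ a : ℝ, 0 < a → a ≤ α₀ →
      ∃ t₀ : ℕ, ∀ t : ℕ, t₀ ≤ t →
        ∀ (B : Type) [DecidableEq B], ∀ (V : Finset B) (E : Finset (Finset B)),
          V.card = t → (∀ e ∈ E, e ⊆ V ∧ e.card = k) →
          PerturbedDegLB k d a (δ + μ) V E →
          (∀ v ∈ V, ∃ e ∈ E, v ∈ e) →
          ∃ C : Finset B → Finset (Finset B), IsHamVicinity k d γ δ V E C


def prs (V : Finset A) (C : Finset (Finset A)) : Finset (A × A) :=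
  (V ×ˢ V).filter fun p => ({p.1, p.2} : Finset A) ∈ C

def nbr (V : Finset A) (C : Finset (Finset A)) (u : A) : Finset A :=
  V.filter fun v => ({u, v} : Finset A) ∈ C

lemma pair_ne_of_mem {V : Finset A} {C : Finset (Finset A)} (hC : C ⊆ V.powersetCard 2)
    {u v : A} (h : ({u, v} : Finset A) ∈ C) : u ≠ v ∧ u ∈ V ∧ v ∈ V := by
  have h1 := mem_powersetCard.1 (hC h)
  refine ⟨?_, h1.1 (by simp), h1.1 (by simp)⟩
  rintro rfl
  have := h1.2
  simp at this

lemma card_prs {V : Finset A} {C : Finset (Finset A)} (hC : C ⊆ V.powersetCard 2) :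
    (prs V C).card = 2 * C.card := by
  have hm : ∀ p ∈ prs V C, (({p.1, p.2} : Finset A)) ∈ C := fun p hp => (mem_filter.1 hp).2
  rw [card_eq_sum_card_fiberwise hm, sum_const_nat (m := 2), mul_comm]
  intro e he
  have h1 := mem_powersetCard.1 (hC he)
  obtain ⟨a, b, hab, rfl⟩ := card_eq_two.1 h1.2
  have : (prs V C).filter (fun p => ({p.1, p.2} : Finset A) = {a, b}) = {(a, b), (b, a)} := by
    ext ⟨x, y⟩
    have ha : a ∈ V := h1.1 (by simp)
    have hb : b ∈ V := h1.1 (by simp)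
    simp only [prs, mem_filter, mem_product, mem_insert, mem_singleton, Prod.mk.injEq]
    constructor
    · rintro ⟨⟨_, h3⟩, h4⟩
      have hne := (pair_ne_of_mem hC h3).1
      have hx : x ∈ ({a, b} : Finset A) := h4 ▸ (by simp)
      have hy : y ∈ ({a, b} : Finset A) := h4 ▸ (by simp)
      simp only [mem_insert, mem_singleton] at hx hy
      grind
    · rintro (⟨rfl, rfl⟩ | ⟨rfl, rfl⟩)
      · exact ⟨⟨⟨ha, hb⟩, he⟩, rfl⟩
      · exact ⟨⟨⟨hb, ha⟩, by rw [Finset.pair_comm]; exact he⟩, Finset.pair_comm _ _⟩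
  rw [this, card_pair]
  simp [hab]

lemma card_prs_eq_sum (V : Finset A) (C : Finset (Finset A)) :
    (prs V C).card = ∑ u ∈ V, (nbr V C u).card := by
  rw [prs, card_filter, sum_product]
  simp only [nbr, card_filter]

/-- the triangle lemma -/
lemma exists_switcher {X : Finset A} {C : Finset (Finset A)} (hC : C ⊆ X.powersetCard 2)
    (h : X.card ^ 2 < 4 * C.card) : HasSwitcher C := by
  by_cases htri : ∃ a b c : A, ({a, b} : Finset A) ∈ C ∧ ({a, c} : Finset A) ∈ C ∧
      ({b, c} : Finset A) ∈ C
  · obtain ⟨a, b, c, hab, hac, hbc⟩ := htri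
    have h1 := (pair_ne_of_mem hC hab).1
    have h2 := (pair_ne_of_mem hC hac).1
    have h3 := (pair_ne_of_mem hC hbc).1
    have e1 : ({a, b} : Finset A).erase a = {b} := by ext x; simp; grind
    have e2 : ({a, b} : Finset A).erase b = {a} := by ext x; simp; grind
    have hcb : ({c, b} : Finset A) ∈ C := by rwa [Finset.pair_comm]
    have hca : ({c, a} : Finset A) ∈ C := by rwa [Finset.pair_comm]
    refine ⟨{a, b}, hab, a, by simp, fun x hx => ⟨c, by simp; grind, by rw [e1]; exact hcb, ?_⟩⟩
    simp only [mem_insert, mem_singleton] at hx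
    rcases hx with rfl | rfl
    · rw [e1]; exact hcb
    · rw [e2]; exact hca
  · exfalso
    have hdeg : ∀ p ∈ prs X C, (nbr X C p.1).card + (nbr X C p.2).card ≤ X.card := by
      intro p hp
      rw [← card_union_of_disjoint]
      · exact card_le_card (union_subset (filter_subset _ _) (filter_subset _ _))
      · rw [disjoint_left]
        intro c hc hc'
        exact htri ⟨p.1, p.2, c, (mem_filter.1 hp).2, (mem_filter.1 hc).2, (mem_filter.1 hc').2⟩
    have hs := sum_le_sum hdeg
    rw [sum_const, smul_eq_mul, sum_add_distrib] at hs
    have e1 : ∑ p ∈ prs X C, (nbr X C p.1).card = ∑ u ∈ X, (nbr X C u).card ^ 2 := by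
      rw [prs, sum_filter, sum_product]
      refine sum_congr rfl fun u _ => ?_
      simp only
      rw [← sum_filter, sum_const, smul_eq_mul, sq]; rfl
    have e2 : ∑ p ∈ prs X C, (nbr X C p.2).card = ∑ u ∈ X, (nbr X C u).card ^ 2 := by
      rw [prs, sum_filter, sum_product_right]
      refine sum_congr rfl fun u _ => ?_
      simp only
      rw [← sum_filter, sum_const, smul_eq_mul, sq]
      congr 1
      rw [nbr]; congr 1; ext v; simp [Finset.pair_comm]
    rw [e1, e2] at hs
    have cs : (∑ u ∈ X, (nbr X C u).card) ^ 2 ≤ X.card * ∑ u ∈ X, (nbr X C u).card ^ 2 :=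
      sq_sum_le_card_mul_sum_sq
    rw [← card_prs_eq_sum] at cs
    rw [card_prs hC] at cs hs
    have : 0 < C.card := by
      by_contra hh
      have : C.card = 0 := by omega
      rw [this] at h; omega
    have h4 : X.card * (4 * ∑ u ∈ X, (nbr X C u).card ^ 2) ≤ X.card * (2 * (2 * C.card * X.card)) := by
      exact Nat.mul_le_mul_left _ (by omega)
    have h5 : 8 * C.card * (2 * C.card) ≤ 8 * C.card * (X.card ^2) * 1 := by nlinarith
    nlinarith

lemma exists_walk {C : Finset (Finset A)} {a c : A}
    (h : Relation.ReflTransGen (fun u v => ({u, v} : Finset A) ∈ C) a c) :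
    ∀ b d : A, ({b, a} : Finset A) ∈ C → ({c, d} : Finset A) ∈ C →
    ∃ w : List A, IsTightWalk 2 C (b :: a :: w) ∧ EdgeOnWalk 2 (b :: a :: w) {c, d} := by
  induction h using Relation.ReflTransGen.head_induction_on with
  | refl =>
    intro b d hb hd
    refine ⟨[d], ⟨by simp, ?_⟩, 1, by simp, by simp [walkEdgeAt]⟩
    intro i hi
    simp at hi
    have : i = 0 ∨ i = 1 := by omega
    rcases this with rfl | rfl
    · simpa [walkEdgeAt] using hb
    · simpa [walkEdgeAt] using hd
  | head h1 h2 ih =>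
    rename_i a a'
    intro b d hb hd
    obtain ⟨w, ⟨hw1, hw2⟩, i, hi, hi'⟩ := ih a d h1 hd
    refine ⟨a' :: w, ⟨by simp, ?_⟩, i + 1, by simp at hi ⊢; omega, by
      simpa [walkEdgeAt] using hi'⟩
    intro j hj
    rcases j with _ | j
    · simpa [walkEdgeAt] using hb
    · have := hw2 j (by simp at hj ⊢; omega)
      simpa [walkEdgeAt] using this

/-- a good component -/
structure Good (ν : ℝ) (V X : Finset A) (C : Finset (Finset A)) : Prop where
  sub : X ⊆ V
  hC : C ⊆ X.powersetCard 2
  conn : TightlyConnected 2 C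
  big : 2 * (V.card : ℝ) ≤ 3 * X.card
  edges : (5 / 9 + ν) * (V.card : ℝ) ^ 2 ≤ 2 * C.card + ((V.card : ℝ) - X.card) ^ 2

lemma exists_good {ν : ℝ} (hν : 0 < ν) {V : Finset A} {L : Finset (Finset A)}
    (hL : L ⊆ V.powersetCard 2) (hV : 0 < V.card)
    (h : (5 / 9 + ν) * (V.card : ℝ) ^ 2 ≤ 2 * L.card) :
    ∃ X C, C ⊆ L ∧ Good ν V X C := by
  classical
  let R : A → A → Prop := Relation.ReflTransGen (fun u v => ({u, v} : Finset A) ∈ L)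
  have hsym : ∀ u v, R u v → R v u := by
    intro u v huv
    induction huv with
    | refl => exact .refl
    | tail h1 h2 ih =>
      exact Relation.ReflTransGen.head (by rwa [Finset.pair_comm]) ih
  let K : A → Finset A := fun v => V.filter (R v)
  obtain ⟨v, hv, hmax⟩ := exists_max_image V (fun v => (K v).card) (card_pos.1 hV)
  set X := K v with hX
  have hXV : X ⊆ V := filter_subset _ _
  set C := L.filter (fun e => e ⊆ X) with hCdef
  have hCL : C ⊆ L := filter_subset _ _
  have hstep : ∀ x y, x ∈ X → ({x, y} : Finset A) ∈ L → y ∈ X := by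
    intro x y hx hxy
    exact mem_filter.2 ⟨(pair_ne_of_mem hL hxy).2.2, (mem_filter.1 hx).2.tail hxy⟩
  have hCX : C ⊆ X.powersetCard 2 := by
    intro e he
    have := mem_filter.1 he
    exact mem_powersetCard.2 ⟨this.2, (mem_powersetCard.1 (hL this.1)).2⟩
  have hpL := card_prs hL
  -- size
  have hs1 : (prs V L).card ≤ V.card * X.card := by
    rw [card_prs_eq_sum, ← smul_eq_mul]
    apply sum_le_card_nsmul
    intro u hu
    refine le_trans (card_le_card ?_) (hmax u hu)
    intro w hw
    have := mem_filter.1 hw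
    exact mem_filter.2 ⟨this.1, Relation.ReflTransGen.single this.2⟩
  have hsplit : prs V L ⊆ prs X C ∪ (V \ X) ×ˢ (V \ X) := by
    rintro ⟨x, y⟩ hp
    have hp' := mem_filter.1 hp
    have hxy := hp'.2
    simp only at hxy
    have hV' := mem_product.1 hp'.1
    by_cases hx : x ∈ X
    · have hy := hstep x y hx hxy
      refine mem_union_left _ (mem_filter.2 ⟨mem_product.2 ⟨hx, hy⟩, mem_filter.2 ⟨hxy, ?_⟩⟩)
      intro z hz
      simp only [mem_insert, mem_singleton] at hz
      rcases hz with rfl | rfl <;> assumption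
    · have hy : y ∉ X := fun hy => hx (hstep y x hy (by rwa [Finset.pair_comm]))
      exact mem_union_right _ (mem_product.2 ⟨mem_sdiff.2 ⟨hV'.1, hx⟩, mem_sdiff.2 ⟨hV'.2, hy⟩⟩)
  have hs2 := (card_le_card hsplit).trans (card_union_le _ _)
  have hcX : (prs X C).card ≤ X.card * X.card := by
    rw [← card_product]; exact card_le_card (filter_subset _ _)
  rw [card_product, card_prs hCX] at hs2
  rw [card_prs hCX] at hcX
  rw [hpL] at hs1 hs2
  have hle := card_le_card hXV
  have hsd : ((V \ X).card : ℝ) = (V.card : ℝ) - X.card := by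
    rw [card_sdiff_of_subset hXV, Nat.cast_sub hle]
  have hs1' : 2 * (L.card : ℝ) ≤ V.card * X.card := by exact_mod_cast hs1
  have hs2' : 2 * (L.card : ℝ) ≤ 2 * C.card + ((V \ X).card : ℝ) * (V \ X).card := by
    exact_mod_cast hs2
  have hcX' : 2 * (C.card : ℝ) ≤ X.card * X.card := by exact_mod_cast hcX
  rw [hsd] at hs2'
  have ht : (0 : ℝ) < V.card := by exact_mod_cast hV
  have hle' : (X.card : ℝ) ≤ V.card := by exact_mod_cast hle
  refine ⟨X, C, hCL, hXV, hCX, ?_, ?_, by nlinarith⟩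
  · intro e₁ he₁ e₂ he₂
    obtain ⟨a, b, hab, rfl⟩ := card_eq_two.1 (mem_powersetCard.1 (hCX he₁)).2
    obtain ⟨c, d, hcd, rfl⟩ := card_eq_two.1 (mem_powersetCard.1 (hCX he₂)).2
    have haX := (pair_ne_of_mem hCX he₁).2.1
    have hcX := (pair_ne_of_mem hCX he₂).2.1
    have hac : R a c := (hsym _ _ (mem_filter.1 haX).2).trans (mem_filter.1 hcX).2
    have : ∀ z, R a z → z ∈ X ∧ Relation.ReflTransGen (fun u v => ({u, v} : Finset A) ∈ C) a z := by
      intro z hz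
      induction hz with
      | refl => exact ⟨haX, .refl⟩
      | tail h1 h2 ih =>
        rename_i y z
        have hzX := hstep _ _ ih.1 h2
        refine ⟨hzX, ih.2.tail (mem_filter.2 ⟨h2, ?_⟩)⟩
        intro q hq
        simp only [mem_insert, mem_singleton] at hq
        rcases hq with rfl | rfl
        · exact ih.1
        · exact hzX
    obtain ⟨w, hw1, hw2⟩ := exists_walk (this c hac).2 b d (by rwa [Finset.pair_comm]) he₂
    refine ⟨_, hw1, ⟨0, by simp, ?_⟩, hw2⟩
    simp [walkEdgeAt, Finset.pair_comm]
  · have h1 : (5 / 9 : ℝ) * V.card ≤ X.card := by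
      by_contra hh
      push Not at hh
      nlinarith [mul_pos ht ht]
    by_contra hh
    push Not at hh
    have h2 : (5 / 9 + ν) * (V.card : ℝ) ^ 2 ≤ X.card * X.card + ((V.card : ℝ) - X.card) ^ 2 := by
      nlinarith
    nlinarith [mul_pos hν (mul_pos ht ht), mul_nonneg (sub_nonneg.2 h1) (sub_nonneg.2 hh.le)]

lemma good_inter {ν : ℝ} (hν : 0 < ν) {V X X' : Finset A} {C C' : Finset (Finset A)}
    (hV : 0 < V.card) (h : Good ν V X C) (h' : Good ν V X' C') : (C ∩ C').Nonempty := by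
  by_contra hne
  rw [not_nonempty_iff_eq_empty] at hne
  have hdis : Disjoint (prs X C) (prs X' C') := by
    rw [disjoint_left]
    intro p hp hp'
    have : ({p.1, p.2} : Finset A) ∈ C ∩ C' :=
      mem_inter.2 ⟨(mem_filter.1 hp).2, (mem_filter.1 hp').2⟩
    rw [hne] at this
    simp at this
  have h1 : prs X C ∪ prs X' C' ⊆ X ×ˢ X ∪ X' ×ˢ X' :=
    union_subset_union (filter_subset _ _) (filter_subset _ _)
  have h2 := card_le_card h1
  rw [card_union_of_disjoint hdis, card_prs h.hC, card_prs h'.hC] at h2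
  have h3 := card_union_add_card_inter (X ×ˢ X) (X' ×ˢ X')
  rw [product_inter_product, card_product, card_product, card_product] at h3
  have h4 := card_union_add_card_inter X X'
  have h5 := card_le_card (union_subset h.sub h'.sub)
  have h6 := card_le_card h.sub
  have h7 := card_le_card h'.sub
  have e1 := h.edges
  have e2 := h'.edges
  have b1 := h.big
  have b2 := h'.big
  have h2' : 2 * (C.card : ℝ) + 2 * C'.card + (X ∩ X').card * (X ∩ X').card
      ≤ X.card * X.card + X'.card * X'.card := by
    exact_mod_cast (by omega : 2 * C.card + 2 * C'.card + (X ∩ X').card * (X ∩ X').card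
      ≤ X.card * X.card + X'.card * X'.card)
  have hz : (X.card : ℝ) + X'.card - V.card ≤ (X ∩ X').card := by
    have : X.card + X'.card ≤ (X ∩ X').card + V.card := by omega
    have : (X.card : ℝ) + X'.card ≤ (X ∩ X').card + V.card := by exact_mod_cast this
    linarith
  have h6' : (X.card : ℝ) ≤ V.card := by exact_mod_cast h6
  have h7' : (X'.card : ℝ) ≤ V.card := by exact_mod_cast h7
  have ht : (0 : ℝ) < V.card := by exact_mod_cast hV
  generalize (V.card : ℝ) = t at *
  generalize (X.card : ℝ) = x at *
  generalize (X'.card : ℝ) = x' at *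
  generalize ((X ∩ X').card : ℝ) = z at *
  have hz0 : 0 ≤ x + x' - t := by linarith
  have hzz : (x + x' - t) * (x + x' - t) ≤ z * z := mul_self_le_mul_self hz0 hz
  have hd : (x - x') ^ 2 ≤ (t / 3) ^ 2 := sq_le_sq' (by linarith) (by linarith)
  nlinarith [mul_pos hν (mul_pos ht ht)]

lemma fracMatching_of_hall {V : Finset A} {C : Finset (Finset A)} (hC : C ⊆ V.powersetCard 2)
    (D : ℕ) (hall : ∀ S ⊆ V, S.card ≤ (S.biUnion (nbr V C)).card + D) {m : ℝ}
    (hm : 2 * m ≤ (V.card : ℝ) - D) : HasFracMatching C m := by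
  classical
  let F : {x // x ∈ V} → Finset (A ⊕ Fin D) := fun u => (nbr V C u.1).disjSum univ
  have hF : ∀ s : Finset {x // x ∈ V}, s.card ≤ (s.biUnion F).card := by
    intro s
    rcases s.eq_empty_or_nonempty with rfl | ⟨u0, hu0⟩
    · simp
    have h1 := hall (s.image Subtype.val) (by
      intro x hx
      obtain ⟨y, _, rfl⟩ := mem_image.1 hx
      exact y.2)
    rw [card_image_of_injective _ Subtype.val_injective] at h1
    have h2 : ((s.image Subtype.val).biUnion (nbr V C)).disjSum (univ : Finset (Fin D))
        ⊆ s.biUnion F := by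
      intro z hz
      rw [mem_biUnion]
      rcases mem_disjSum.1 hz with ⟨x, hx, rfl⟩ | ⟨x, hx, rfl⟩
      · obtain ⟨y, hy, hxy⟩ := mem_biUnion.1 hx
        obtain ⟨y', hy', rfl⟩ := mem_image.1 hy
        exact ⟨y', hy', inl_mem_disjSum.2 hxy⟩
      · exact ⟨u0, hu0, inr_mem_disjSum.2 (mem_univ _)⟩
    have h3 := card_le_card h2
    rw [card_disjSum, card_univ, Fintype.card_fin] at h3
    omega
  obtain ⟨f, hinj, hf⟩ := (Finset.all_card_le_biUnion_card_iff_exists_injective F).1 hF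
  -- matched arcs
  let M : Finset (A × A) := (V ×ˢ V).filter fun p => ∃ h : p.1 ∈ V, f ⟨p.1, h⟩ = Sum.inl p.2
  have hM : ∀ p, p ∈ M ↔ ∃ h : p.1 ∈ V, f ⟨p.1, h⟩ = Sum.inl p.2 := by
    intro p
    refine ⟨fun h => (mem_filter.1 h).2, fun h => mem_filter.2 ⟨?_, h⟩⟩
    obtain ⟨h1, h2⟩ := h
    have h3 := hf ⟨p.1, h1⟩
    rw [h2] at h3
    exact mem_product.2 ⟨h1, (mem_filter.1 (inl_mem_disjSum.1 h3)).1⟩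
  clear_value M
  have hMC : ∀ p ∈ M, ({p.1, p.2} : Finset A) ∈ C := by
    intro p hp
    obtain ⟨h1, h2⟩ := (hM p).1 hp
    have h3 := hf ⟨p.1, h1⟩
    rw [h2] at h3
    exact (mem_filter.1 (inl_mem_disjSum.1 h3)).2
  have hM1 : ∀ p ∈ M, ∀ q ∈ M, p.1 = q.1 → p = q := by
    rintro ⟨p1, p2⟩ hp ⟨q1, q2⟩ hq h
    obtain ⟨h1, h2⟩ := (hM _).1 hp
    obtain ⟨h3, h4⟩ := (hM _).1 hq
    simp only at h h1 h2 h3 h4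
    subst h
    rw [h2] at h4
    simpa using h4
  have hM2 : ∀ p ∈ M, ∀ q ∈ M, p.2 = q.2 → p = q := by
    rintro ⟨p1, p2⟩ hp ⟨q1, q2⟩ hq h
    obtain ⟨h1, h2⟩ := (hM _).1 hp
    obtain ⟨h3, h4⟩ := (hM _).1 hq
    simp only at h h1 h2 h3 h4
    subst h
    have := hinj (h2.trans h4.symm)
    simpa using this
  have hMcard : V.card ≤ M.card + D := by
    have h1 : (univ.image f) ⊆ (M.image Prod.snd).disjSum (univ : Finset (Fin D)) := by
      intro z hz
      obtain ⟨u, _, rfl⟩ := mem_image.1 hz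
      rcases hfu : f u with x | x
      · exact inl_mem_disjSum.2 (mem_image.2 ⟨(u.1, x), (hM _).2 ⟨u.2, hfu⟩, rfl⟩)
      · exact inr_mem_disjSum.2 (mem_univ _)
    have h2 := card_le_card h1
    rw [card_image_of_injective _ hinj, card_disjSum, card_univ, card_univ, Fintype.card_fin,
      Fintype.card_coe] at h2
    have := card_image_le (s := M) (f := Prod.snd)
    omega
  have hv : ∀ v : A, (M.filter fun p => v ∈ ({p.1, p.2} : Finset A)).card ≤ 2 := by
    intro v
    have : (M.filter fun p => v ∈ ({p.1, p.2} : Finset A))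
        ⊆ (M.filter fun p => p.1 = v) ∪ (M.filter fun p => p.2 = v) := by
      intro p hp
      simp only [mem_filter, mem_insert, mem_singleton, mem_union] at hp ⊢
      grind
    refine (card_le_card this).trans ((card_union_le _ _).trans ?_)
    have h1 : (M.filter fun p => p.1 = v).card ≤ 1 := by
      rw [card_le_one]
      intro p hp q hq
      have hp := mem_filter.1 hp
      have hq := mem_filter.1 hq
      exact hM1 p hp.1 q hq.1 (hp.2.trans hq.2.symm)
    have h2 : (M.filter fun p => p.2 = v).card ≤ 1 := by
      rw [card_le_one]
      intro p hp q hq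
      have hp := mem_filter.1 hp
      have hq := mem_filter.1 hq
      exact hM2 p hp.1 q hq.1 (hp.2.trans hq.2.symm)
    omega
  let w : Finset A → ℝ := fun e => ((M.filter fun p => ({p.1, p.2} : Finset A) = e).card : ℝ) / 2
  refine ⟨w, ?_, ?_, ?_⟩
  · intro e he
    refine ⟨by positivity, ?_⟩
    obtain ⟨a, b, hab, rfl⟩ := card_eq_two.1 (mem_powersetCard.1 (hC he)).2
    have h1 : (M.filter fun p => ({p.1, p.2} : Finset A) = {a, b}).card ≤ 2 := by
      refine le_trans (card_le_card ?_) (hv a)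
      intro p hp
      have hp := mem_filter.1 hp
      exact mem_filter.2 ⟨hp.1, by rw [hp.2]; simp⟩
    have h1' : ((M.filter fun p => ({p.1, p.2} : Finset A) = {a, b}).card : ℝ) ≤ 2 := by
      exact_mod_cast h1
    show _ / 2 ≤ (1 : ℝ)
    linarith
  · intro v
    have h1 : ∑ e ∈ C.filter (fun e' => v ∈ e'),
        (M.filter fun p => ({p.1, p.2} : Finset A) = e).card ≤ 2 := by
      refine le_trans (le_of_eq ?_) (hv v)
      rw [card_eq_sum_card_fiberwise (f := fun p : A × A => ({p.1, p.2} : Finset A))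
        (t := C.filter (fun e' => v ∈ e'))]
      · refine sum_congr rfl fun e he => ?_
        rw [filter_filter]
        congr 1
        ext p
        simp only [mem_filter]
        have := (mem_filter.1 he).2
        constructor
        · rintro ⟨h1, rfl⟩; exact ⟨h1, this, rfl⟩
        · rintro ⟨h1, _, h2⟩; exact ⟨h1, h2⟩
      · intro p hp
        have hp := mem_filter.1 (mem_coe.1 hp)
        exact mem_coe.2 (mem_filter.2 ⟨hMC p hp.1, hp.2⟩)
    have h1' : ∑ e ∈ C.filter (fun e' => v ∈ e'),
        ((M.filter fun p => ({p.1, p.2} : Finset A) = e).card : ℝ) ≤ 2 := by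
      exact_mod_cast h1
    show ∑ e ∈ C.filter (fun e' => v ∈ e'), _ / (2 : ℝ) ≤ 1
    rw [← sum_div]
    linarith
  · have h1 : M.card = ∑ e ∈ C, (M.filter fun p => ({p.1, p.2} : Finset A) = e).card :=
      card_eq_sum_card_fiberwise (fun p hp => hMC p hp)
    have h1' : (M.card : ℝ) = ∑ e ∈ C, ((M.filter fun p => ({p.1, p.2} : Finset A) = e).card : ℝ) := by
      exact_mod_cast h1
    show m ≤ ∑ e ∈ C, _ / (2 : ℝ)
    rw [← sum_div, ← h1']
    have : (V.card : ℝ) ≤ M.card + D := by exact_mod_cast hMcard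
    linarith

lemma arith_case {t c y a γ ν : ℝ} (ht : 0 < t) (hc : 0 ≤ c) (hy : 0 ≤ y) (ha : 0 ≤ a)
    (hy3 : 3 * y ≤ t) (hγ : 0 < γ) (hν : 10 * γ ≤ ν) 
    (h1 : a ≤ c + y - (1 / 3 - 2 * γ) * t) (h2 : a + c + y ≤ t)
    (h : (5 / 9 + ν) * t ^ 2 ≤ (t - y - c) ^ 2 + 2 * c * a + y ^ 2) : False := by
  have htt := mul_pos ht ht
  have hgt : 0 < γ * t := by positivity
  have hgtt : 0 < γ * t * t := by positivity
  have hνt : 10 * γ * t ^ 2 ≤ ν * t ^ 2 := by gcongr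
  rcases le_total (3 * (c + y)) (2 * t) with hs | hs
  · have e1 : c * a ≤ c * (c + y - (1 / 3 - 2 * γ) * t) := by gcongr
    have e2 : c * (c - 2 / 3 * t) ≤ 0 := mul_nonpos_of_nonneg_of_nonpos hc (by linarith)
    have e3 : 0 ≤ (c + y - (1 / 3 - 2 * γ) * t) * (2 / 3 * t - (c + y)) :=
      mul_nonneg (by linarith) (by linarith)
    have e4 : γ * t * (c + y) ≤ γ * t * t := by gcongr; linarith
    have e5 : γ * t * c ≤ γ * t * t := by gcongr; linarith
    nlinarith
  · have e1 : c * a ≤ c * (t - y - c) := by gcongr; linarith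
    have e2 : (2 / 3 * t - y) * (2 / 3 * t - y) ≤ c * c :=
      mul_self_le_mul_self (by linarith) (by linarith)
    have e3 : y * (y - 2 / 3 * t) ≤ 0 := mul_nonpos_of_nonneg_of_nonpos hy (by linarith)
    nlinarith

lemma good_matching {ν γ : ℝ} {V X : Finset A} {C : Finset (Finset A)}
    (hV : 0 < V.card) (h : Good ν V X C) (hγ : 0 < γ) (hν : 10 * γ ≤ ν) (hγ1 : γ ≤ 1 / 100) :
    HasFracMatching C ((1 / 3 + γ) * V.card) := by
  have ht : (0 : ℝ) < V.card := by exact_mod_cast hV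
  have hCV : C ⊆ V.powersetCard 2 := h.hC.trans (powersetCard_mono h.sub)
  have hnn : 0 ≤ (1 / 3 - 2 * γ) * V.card := by
    apply mul_nonneg _ ht.le
    linarith
  refine fracMatching_of_hall hCV ⌊(1 / 3 - 2 * γ) * V.card⌋₊ ?_ ?_
  · intro S hS
    by_contra hlt
    push Not at hlt
    set N := S.biUnion (nbr V C) with hN
    have hNX : N ⊆ X := by
      intro v hv
      obtain ⟨u, _, hu⟩ := mem_biUnion.1 hv
      exact (pair_ne_of_mem h.hC (mem_filter.1 hu).2).2.2
    have hmemN : ∀ u v, u ∈ S → ({u, v} : Finset A) ∈ C → v ∈ N := by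
      intro u v hu huv
      exact mem_biUnion.2 ⟨u, hu, mem_filter.2 ⟨(pair_ne_of_mem hCV huv).2.2, huv⟩⟩
    set I := (S \ N) ∩ X with hI
    set N' := N \ S with hN'
    have hIX : I ⊆ X := inter_subset_right
    have hkey : ∀ u v, u ∈ I → ({u, v} : Finset A) ∈ C → v ∈ N' := by
      intro u v hu huv
      have hu' := mem_sdiff.1 (mem_inter.1 hu).1
      refine mem_sdiff.2 ⟨hmemN u v hu'.1 huv, fun hv => hu'.2 (hmemN v u hv ?_)⟩
      rwa [Finset.pair_comm]
    have hsub : prs X C ⊆ ((X \ I) ×ˢ (X \ I)) ∪ (I ×ˢ N' ∪ N' ×ˢ I) := by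
      rintro ⟨u, v⟩ hp
      have hp' := mem_filter.1 hp
      have huv := hp'.2
      simp only at huv
      have hX := mem_product.1 hp'.1
      simp only at hX
      by_cases hu : u ∈ I
      · have := hkey u v hu huv
        simp [hu, this]
      · by_cases hv : v ∈ I
        · have := hkey v u hv (by rwa [Finset.pair_comm])
          simp [hv, this]
        · simp [hu, hv, hX.1, hX.2]
    have h1 := (card_le_card hsub).trans ((card_union_le _ _).trans
      (Nat.add_le_add_left (card_union_le _ _) _))
    rw [card_prs h.hC, card_product, card_product, card_product] at h1
    have hXI : ((X \ I).card : ℝ) = X.card - I.card := by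
      rw [card_sdiff_of_subset hIX, Nat.cast_sub (card_le_card hIX)]
    have h1' : 2 * (C.card : ℝ) ≤ ((X \ I).card : ℝ) * (X \ I).card +
        (I.card * N'.card + N'.card * I.card) := by exact_mod_cast h1
    rw [hXI] at h1'
    have h2 : (S \ N).card ≤ I.card + (V \ X).card := by
      refine le_trans (card_le_card ?_) (card_union_le _ _)
      intro x hx
      by_cases hxX : x ∈ X
      · exact mem_union_left _ (mem_inter.2 ⟨hx, hxX⟩)
      · exact mem_union_right _ (mem_sdiff.2 ⟨hS (mem_sdiff.1 hx).1, hxX⟩)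
    have h3 : (S \ N).card + (S ∩ N).card = S.card := card_sdiff_add_card_inter _ _
    have h4 : (N \ S).card + (N ∩ S).card = N.card := card_sdiff_add_card_inter _ _
    rw [inter_comm] at h4
    have h4' : N'.card + (S ∩ N).card = N.card := h4
    have hXle := card_le_card h.sub
    have hVX : (V \ X).card = V.card - X.card := card_sdiff_of_subset h.sub
    have h5 : I.card + N'.card ≤ X.card := by
      rw [← card_union_of_disjoint]
      · exact card_le_card (union_subset hIX (sdiff_subset.trans hNX))
      · rw [disjoint_left]
        intro x hx hx'
        exact (mem_sdiff.1 hx').2 (mem_sdiff.1 (mem_inter.1 hx).1).1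
    have h6 : N'.card + ⌊(1 / 3 - 2 * γ) * (V.card : ℝ)⌋₊ + 1 + X.card ≤ I.card + V.card := by
      omega
    have h6' : (N'.card : ℝ) + ⌊(1 / 3 - 2 * γ) * (V.card : ℝ)⌋₊ + 1 + X.card
      ≤ I.card + V.card := by exact_mod_cast h6
    have h7 := Nat.lt_floor_add_one ((1 / 3 - 2 * γ) * (V.card : ℝ))
    have h5' : (I.card : ℝ) + N'.card ≤ X.card := by exact_mod_cast h5
    have hXle' : (X.card : ℝ) ≤ V.card := by exact_mod_cast hXle
    have hb := h.big
    have he := h.edges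
    refine arith_case (t := V.card) (c := I.card) (y := (V.card : ℝ) - X.card) (a := N'.card)
      ht (Nat.cast_nonneg _) (by linarith) (Nat.cast_nonneg _) (by linarith) hγ hν
      (by linarith) (by linarith) ?_
    nlinarith
  · have := Nat.floor_le hnn
    linarith

lemma good_switcher {ν : ℝ} (hν : 0 < ν) {V X : Finset A} {C : Finset (Finset A)}
    (hV : 0 < V.card) (h : Good ν V X C) : HasSwitcher C := by
  apply exists_switcher h.hC
  have ht : (0 : ℝ) < V.card := by exact_mod_cast hV
  have hle : (X.card : ℝ) ≤ V.card := by exact_mod_cast card_le_card h.sub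
  have hb := h.big
  have he := h.edges
  have : (X.card : ℝ) ^ 2 < 4 * C.card := by
    nlinarith [mul_pos hν (mul_pos ht ht), mul_pos ht ht,
      mul_nonneg (sub_nonneg.2 hle) (sub_nonneg.2 hb)]
  exact_mod_cast this

lemma good_edges {ν : ℝ} {V X : Finset A} {C : Finset (Finset A)}
    (h : Good ν V X C) : (4 / 9 + ν) * (V.card : ℝ) ^ 2 ≤ 2 * C.card := by
  have hle : (X.card : ℝ) ≤ V.card := by exact_mod_cast card_le_card h.sub
  have hb := h.big
  have he := h.edges
  have : ((V.card : ℝ) - X.card) ^ 2 ≤ (V.card / 3) ^ 2 := sq_le_sq' (by linarith) (by linarith)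
  nlinarith

/-- the combinatorial core of the arc -/
lemma exists_high_deg {V : Finset A} {C : Finset (Finset A)} (hC : C ⊆ V.powersetCard 2)
    (hV : 0 < V.card) (h : 4 / 9 * (V.card : ℝ) ^ 2 ≤ 2 * C.card) :
    ∃ v ∈ V, 4 / 9 * (V.card : ℝ) ≤ (nbr V C v).card := by
  by_contra hh
  push Not at hh
  have h1 := card_prs_eq_sum V C
  rw [card_prs hC] at h1
  have h1' : 2 * (C.card : ℝ) = ∑ u ∈ V, ((nbr V C u).card : ℝ) := by exact_mod_cast h1
  have h2 := sum_lt_sum_of_nonempty (card_pos.1 hV) hh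
  rw [sum_const, nsmul_eq_mul] at h2
  nlinarith

lemma exists_arc_end {V N : Finset A} {C : Finset (Finset A)} (hC : C ⊆ V.powersetCard 2)
    (hN : N ⊆ V) {ν : ℝ}
    (hNc : 4 / 9 * (V.card : ℝ) ≤ N.card) (h : (4 / 9 + ν) * (V.card : ℝ) ^ 2 ≤ 2 * C.card)
    (hν : 2 < ν * V.card) (hV : 0 < V.card) (x : A) :
    ∃ w ∈ N, ∃ u, u ≠ x ∧ ({w, u} : Finset A) ∈ C := by
  by_contra hh
  push Not at hh
  have hsub : prs V C ⊆ ((V \ N) ×ˢ (V \ N)) ∪ (V ×ˢ {x} ∪ {x} ×ˢ V) := by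
    rintro ⟨u, v⟩ hp
    have hp' := mem_filter.1 hp
    have huv := hp'.2
    simp only at huv
    have hX := mem_product.1 hp'.1
    simp only at hX
    by_cases hv : v = x
    · simp [hv, hX.1]
    by_cases hu : u = x
    · simp [hu, hX.2]
    have h1 : u ∉ N := fun hu' => hh u hu' v hv huv
    have h2 : v ∉ N := fun hv' => hh v hv' u hu (by rwa [Finset.pair_comm])
    simp [h1, h2, hX.1, hX.2]
  have h1 := (card_le_card hsub).trans ((card_union_le _ _).trans
      (Nat.add_le_add_left (card_union_le _ _) _))
  rw [card_prs hC, card_product, card_product, card_product, card_singleton] at h1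
  have hVN : ((V \ N).card : ℝ) = V.card - N.card := by
    rw [card_sdiff_of_subset hN, Nat.cast_sub (card_le_card hN)]
  have h1' : 2 * (C.card : ℝ) ≤ ((V \ N).card : ℝ) * (V \ N).card +
        (V.card * 1 + 1 * V.card) := by exact_mod_cast h1
  rw [hVN] at h1'
  have hle : (N.card : ℝ) ≤ V.card := by exact_mod_cast card_le_card hN
  have ht : (0 : ℝ) < V.card := by exact_mod_cast hV
  have : ((V.card : ℝ) - N.card) * (V.card - N.card) ≤ (5 / 9 * V.card) * (5 / 9 * V.card) :=
    mul_self_le_mul_self (by linarith) (by linarith)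
  nlinarith [mul_pos ht ht]

lemma mem_shadow' {j : ℕ} {E : Finset (Finset A)} {S : Finset A} :
    S ∈ shadow j E ↔ ∃ e ∈ E, S ⊆ e ∧ S.card = j := by
  simp [_root_.shadow, mem_powersetCard]

lemma mem_link' {E : Finset (Finset A)} {S B : Finset A} (h : B ∈ link S E) :
    Disjoint S B ∧ S ∪ B ∈ E := by
  obtain ⟨e, he, rfl⟩ := mem_image.1 h
  have he := mem_filter.1 he
  exact ⟨disjoint_sdiff, by rw [union_sdiff_of_subset he.2]; exact he.1⟩

lemma card_link (E : Finset (Finset A)) (S : Finset A) :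
    (link S E).card = (E.filter fun e => S ⊆ e).card := by
  apply card_image_of_injOn
  intro e he f hf h
  have he := (mem_filter.1 (mem_coe.1 he)).2
  have hf := (mem_filter.1 (mem_coe.1 hf)).2
  have h : e \ S = f \ S := h
  rw [← union_sdiff_of_subset he, ← union_sdiff_of_subset hf, h]

lemma link_sub {k : ℕ} (hk : 3 ≤ k) {V : Finset A} {E : Finset (Finset A)}
    (hE : ∀ e ∈ E, e ⊆ V ∧ e.card = k) {S : Finset A} (hS : S ∈ shadow (k - 2) E) :
    link S E ⊆ V.powersetCard 2 := by
  intro B hB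
  obtain ⟨h1, h2⟩ := mem_link' hB
  obtain ⟨_, _, _, hc⟩ := mem_shadow'.1 hS
  obtain ⟨h3, h4⟩ := hE _ h2
  rw [card_union_of_disjoint h1] at h4
  exact mem_powersetCard.2 ⟨subset_union_right.trans h3, by omega⟩

lemma arith_deg {k t : ℕ} {μ : ℝ} (hμ : 0 < μ) (hμ1 : μ ≤ 1) (hk : 3 ≤ k) (hkt : k ≤ t)
    (ht : 8 * (k : ℝ) ≤ μ * t) :
    (5 / 9 + μ / 2) * (t : ℝ) ^ 2 ≤ 2 * ((5 / 9 + μ) * (((t - (k - 2)).choose 2 : ℕ) : ℝ)) := by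
  have h1 : (((t - (k - 2)).choose 2 : ℕ) : ℝ) = ((t : ℝ) - k + 2) * ((t : ℝ) - k + 1) / 2 := by
    rw [Nat.cast_choose_two]
    have : ((t - (k - 2) : ℕ) : ℝ) = (t : ℝ) - k + 2 := by
      rw [Nat.cast_sub (by omega), Nat.cast_sub (by omega)]
      push_cast; ring
    rw [this]; ring
  rw [h1]
  have hk' : (3 : ℝ) ≤ k := by exact_mod_cast hk
  have hkt' : (k : ℝ) ≤ t := by exact_mod_cast hkt
  have h2 : (t : ℝ) ^ 2 - 2 * k * t ≤ ((t : ℝ) - k + 2) * ((t : ℝ) - k + 1) := by nlinarith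
  have h3 : (5 / 9 + μ) * ((t : ℝ) ^ 2 - 2 * k * t) ≤
      (5 / 9 + μ) * (((t : ℝ) - k + 2) * ((t : ℝ) - k + 1)) := by gcongr
  have h4 : 8 * (k : ℝ) * t ≤ μ * t * t := by gcongr
  have h5 : μ * ((k : ℝ) * t) ≤ 1 * (k * t) := by gcongr
  nlinarith

lemma exists_arc {k : ℕ} (hk : 3 ≤ k) {V : Finset A} {E : Finset (Finset A)}
    (hE : ∀ e ∈ E, e ⊆ V ∧ e.card = k) {ν : ℝ} (hν0 : 0 < ν) (hν : 2 < ν * V.card)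
    (hV : 0 < V.card) (hEne : E.Nonempty) {C : Finset A → Finset (Finset A)}
    (hC : ∀ S ∈ shadow (k - 2) E, C S ⊆ link S E)
    (hed : ∀ S ∈ shadow (k - 2) E, (4 / 9 + ν) * (V.card : ℝ) ^ 2 ≤ 2 * (C S).card) :
    HasArc k (k - 2) E C := by
  obtain ⟨e0, he0⟩ := hEne
  obtain ⟨S, hSe, hSc⟩ := exists_subset_card_eq (s := e0) (n := k - 2) (by
    rw [(hE e0 he0).2]; omega)
  have hS : S ∈ shadow (k - 2) E := mem_shadow'.2 ⟨e0, he0, hSe, hSc⟩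
  obtain ⟨x, hx⟩ : S.Nonempty := card_pos.1 (by omega)
  set T := S.erase x with hT
  have hTc : T.card = k - 3 := by rw [card_erase_of_mem hx]; omega
  have hxT : x ∉ T := notMem_erase _ _
  have hST : S = insert x T := (insert_erase hx).symm
  have hCS := (hC S hS).trans (link_sub hk hE hS)
  obtain ⟨v, hvV, hv⟩ := exists_high_deg hCS hV (by
    have := hed S hS
    nlinarith [mul_nonneg hν0.le (sq_nonneg (V.card : ℝ))])
  have hNV : nbr V (C S) v ⊆ V := filter_subset _ _
  have ht : (0 : ℝ) < V.card := by exact_mod_cast hV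
  have hvw : ∀ w ∈ nbr V (C S) v, ({v, w} : Finset A) ∈ C S := fun w hw => (mem_filter.1 hw).2
  obtain ⟨w0, hw0⟩ : (nbr V (C S) v).Nonempty := by
    apply card_pos.1
    have : (0 : ℝ) < (nbr V (C S) v).card := lt_of_lt_of_le (mul_pos (by norm_num) ht) hv
    exact_mod_cast this
  have hl0 := mem_link' (hC S hS (hvw w0 hw0))
  have hvS : v ∉ S := fun h => disjoint_left.1 hl0.1 h (by simp)
  have hvT : v ∉ T := fun h => hvS (mem_of_mem_erase h)
  have hS' : insert v T ∈ shadow (k - 2) E := by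
    refine mem_shadow'.2 ⟨_, hl0.2, ?_, by rw [card_insert_of_notMem hvT]; omega⟩
    refine insert_subset (mem_union_right _ (mem_insert_self _ _)) ((erase_subset _ _).trans subset_union_left)
  have hCS' := (hC _ hS').trans (link_sub hk hE hS')
  obtain ⟨w, hw, u, hux, hwu⟩ := exists_arc_end hCS' hNV hv (hed _ hS') hν hV x
  have hl := (mem_link' (hC S hS (hvw w hw))).1
  have hl' := (mem_link' (hC _ hS' hwu)).1
  have hvw' := (pair_ne_of_mem hCS (hvw w hw)).1
  have hwu' := (pair_ne_of_mem hCS' hwu).1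
  have hwS : w ∉ S := fun h => disjoint_left.1 hl h (by simp)
  have huS' : u ∉ insert v T := fun h => disjoint_left.1 hl' h (by simp)
  have hlen : T.toList.length = k - 3 := by rw [length_toList, hTc]
  obtain ⟨n, rfl⟩ : ∃ n, k = n + 3 := ⟨k - 3, by omega⟩
  have hd : n + 3 - 2 = n + 1 := by omega
  have hlen' : T.toList.length = n := by omega
  have hkd : n + 3 - (n + 1) = 2 := by omega
  rw [hd] at *
  have t1 : ((x :: T.toList ++ [v, w, u]).take (n + 1)).toFinset = S := by
    rw [List.take_left' (by simp [hlen'] )]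
    rw [hST]; simp
  have t2 : (((x :: T.toList ++ [v, w, u]).drop (n + 1)).take (n + 3 - (n + 1))).toFinset
      = {v, w} := by
    rw [List.drop_left' (by simp [hlen']), hkd]
    simp
  have t3 : (((x :: T.toList ++ [v, w, u]).drop 1).take (n + 1)).toFinset = insert v T := by
    have : (x :: T.toList ++ [v, w, u]).drop 1 = (T.toList ++ [v]) ++ [w, u] := by simp
    rw [this, List.take_left' (by simp [hlen'])]
    ext z; simp
  have t4 : ((x :: T.toList ++ [v, w, u]).drop (n + 1 + 1)).toFinset = {w, u} := by
    have : (x :: T.toList ++ [v, w, u]) = (x :: T.toList ++ [v]) ++ [w, u] := by simp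
    rw [this, List.drop_left' (by simp [hlen'])]
    simp
  refine ⟨x :: T.toList ++ [v, w, u], by simp [hlen'], ?_, ?_, ?_, ?_, ?_⟩
  · have hxv : x ≠ v := by rintro rfl; exact hvS hx
    have hxw : x ≠ w := by rintro rfl; exact hwS hx
    have hwT : w ∉ T := fun h => hwS (mem_of_mem_erase h)
    have huT : u ∉ T := fun h => huS' (mem_insert_of_mem h)
    have huv : v ≠ u := by rintro rfl; exact huS' (mem_insert_self _ _)
    have hnd := T.nodup_toList
    simp only [List.cons_append, List.nodup_cons, List.nodup_append, List.mem_append, mem_toList,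
      List.mem_cons, List.not_mem_nil, or_false]
    refine ⟨by grind, hnd, by simp; grind, by grind⟩
  · rw [t1]; exact hS
  · rw [t1, t2]; exact hvw w hw
  · rw [t3]; exact hS'
  · rw [t3, t4]; exact hwu

/-- `hv_{k-2}(k) ≤ 5/9`. -/
theorem vicinity_threshold_k_sub_two (k : ℕ) (hk : 3 ≤ k) :
    HamVicinityProp k (k - 2) ((5 : ℝ) / 9) := by
  intro μ hμ
  obtain ⟨μ', hμ', hμ1, hμμ⟩ : ∃ μ' : ℝ, 0 < μ' ∧ μ' ≤ 1 ∧ μ' ≤ μ :=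
    ⟨min μ 1, lt_min hμ one_pos, min_le_right _ _, min_le_left _ _⟩
  refine ⟨μ' / 100, by positivity, fun γ hγ hγ0 => ⟨1, one_pos, fun a _ _ => ?_⟩⟩
  refine ⟨⌈8 * (k : ℝ) / μ'⌉₊, fun t ht B _ V E hVt hE hdeg hiso => ?_⟩
  have hkd : k - (k - 2) = 2 := by omega
  have hk' : (3 : ℝ) ≤ k := by exact_mod_cast hk
  have h8 : 8 * (k : ℝ) ≤ μ' * t := by
    have := Nat.ceil_le.1 ht
    rw [div_le_iff₀ hμ'] at this
    linarith
  have hkt : k ≤ t := by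
    have : (k : ℝ) ≤ t := by nlinarith [Nat.cast_nonneg (α := ℝ) t]
    exact_mod_cast this
  subst hVt
  have hV : 0 < V.card := by omega
  have hEne : E.Nonempty := by
    obtain ⟨v, hv⟩ := card_pos.1 hV
    obtain ⟨e, he, _⟩ := hiso v hv
    exact ⟨e, he⟩
  have hgood : ∀ S : Finset B, ∃ X C, S ∈ shadow (k - 2) E → C ⊆ link S E ∧
      Good (μ' / 2) V X C := by
    intro S
    by_cases hS : S ∈ shadow (k - 2) E
    · have h1 := (hdeg (k - 2) (by omega) le_rfl).1 S hS
      rw [hkd, ← card_link] at h1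
      have h2 := arith_deg hμ' hμ1 hk hkt h8
      have h3 : (5 / 9 + μ') * (((V.card - (k - 2)).choose 2 : ℕ) : ℝ) ≤
        (5 / 9 + μ) * (((V.card - (k - 2)).choose 2 : ℕ) : ℝ) := by gcongr
      obtain ⟨X, C, h4, h5⟩ := exists_good (ν := μ' / 2) (by positivity) (link_sub hk hE hS) hV
        (by linarith)
      exact ⟨X, C, fun _ => ⟨h4, h5⟩⟩
    · exact ⟨∅, ∅, fun h => absurd h hS⟩
  choose X C hXC using hgood
  have hν : 0 < μ' / 2 := by positivity
  have hVr : (0 : ℝ) < V.card := by exact_mod_cast hV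
  refine ⟨C, fun S hS => (hXC S hS).1, ?_, ?_, ?_, ?_, ?_, ?_⟩
  · intro S hS
    rw [hkd]
    exact (hXC S hS).2.conn
  · intro S hS S' hS'
    exact good_inter hν hV (hXC S hS).2 (hXC S' hS').2
  · intro S hS
    exact good_switcher hν hV (hXC S hS).2
  · exact exists_arc hk hE hν (by linarith) hV hEne (fun S hS => (hXC S hS).1)
      (fun S hS => good_edges (hXC S hS).2)
  · intro S hS
    obtain ⟨w, hw1, hw2, hw3⟩ := good_matching hV (hXC S hS).2 hγ (by linarith) (by linarith)
    refine ⟨w, hw1, hw2, le_trans ?_ hw3⟩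
    have : 1 / (k : ℝ) ≤ 1 / 3 := by
      apply one_div_le_one_div_of_le <;> linarith
    gcongr
  · intro S hS
    rw [hkd]
    have h1 := good_edges (hXC S hS).2
    rw [Nat.cast_choose_two]
    have h2 : (1 - 5 / 9 + γ) * (V.card : ℝ) ^ 2 ≤ (4 / 9 + μ' / 2) * (V.card : ℝ) ^ 2 := by
      apply mul_le_mul_of_nonneg_right (by linarith) (sq_nonneg _)
    have h3 : 0 ≤ (1 - 5 / 9 + γ) * (V.card : ℝ) := by
      apply mul_nonneg _ hVr.le; linarith
    nlinarith
end

section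
/- (Connectivity and divisibility of generated graphs.) Let 1 ≤ d ≤ k−1 and let R be a k-graph with a d-vicinity (C_S) indexed by the edges S of ∂_d(R). Suppose that (i) every C_S is tightly connected, (ii) any two members C_S and C_{S'} have an edge in common, and (iii) every C_S contains a switcher and the vicinity admits an arc. Then the k-graph H generated by the vicinity is tightly connected and contains a closed tight walk whose length is congruent to 1 modulo k. -/
open Finset

variable {A : Type*} [DecidableEq A]

namespace GenConn

variable {B : Type*} [DecidableEq B]

def img (k : ℕ) (f : ℕ → B) : Finset B := (Finset.range k).image f

def Step (k : ℕ) (E : Finset (Finset B)) (f g : ℕ → B) : Prop :=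
  img k f ∈ E ∧ img k g ∈ E ∧ ∃ t, ∀ s < k, s ≠ t → f s = g s

abbrev Reach (k : ℕ) (E : Finset (Finset B)) := Relation.ReflTransGen (Step k E)

theorem Step.symm {k : ℕ} {E : Finset (Finset B)} {f g : ℕ → B} (h : Step k E f g) :
    Step k E g f := by
  obtain ⟨h1, h2, t, ht⟩ := h
  exact ⟨h2, h1, t, fun s hs hst => (ht s hs hst).symm⟩

theorem Reach.symm' {k : ℕ} {E : Finset (Finset B)} {f g : ℕ → B} (h : Reach k E f g) :
    Reach k E g f := by
  have : Std.Symm (Step k E) := ⟨fun _ _ h => h.symm⟩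
  exact Std.Symm.symm _ _ h

theorem img_congr {k : ℕ} {f g : ℕ → B} (h : ∀ s < k, f s = g s) : img k f = img k g := by
  apply Finset.image_congr
  intro s hs
  exact h s (by simpa using hs)

theorem reach_of_agree {k : ℕ} {E : Finset (Finset B)} {f g : ℕ → B} (hf : img k f ∈ E)
    (h : ∀ s < k, f s = g s) : Reach k E f g :=
  Relation.ReflTransGen.single ⟨hf, img_congr h ▸ hf, 0, fun s hs _ => h s hs⟩

theorem img_inj {k : ℕ} {f : ℕ → B} (h : (img k f).card = k) {s t : ℕ} (hs : s < k) (ht : t < k)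
    (hst : f s = f t) : s = t := by
  have : Set.InjOn f (Finset.range k : Finset ℕ) := by
    rw [← Finset.card_image_iff]; simpa [img] using h
  exact this (by simpa using hs) (by simpa using ht) hst

theorem mem_img {k : ℕ} {f : ℕ → B} {x : B} : x ∈ img k f ↔ ∃ s < k, f s = x := by
  simp [img]

theorem exists_enum (u : Finset B) (hu : u.Nonempty) : ∃ f : ℕ → B, img u.card f = u := by
  obtain ⟨x0, _⟩ := hu
  refine ⟨fun j => u.toList.getD j x0, ?_⟩
  ext x
  rw [mem_img, ← Finset.mem_toList, List.mem_iff_getElem]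
  constructor
  · rintro ⟨s, hs, h⟩
    have hs' : s < u.toList.length := by simpa using hs
    refine ⟨s, hs', ?_⟩
    rw [← h]; simp [hs]
  · rintro ⟨s, hs, h⟩
    have hs' : s < u.card := by simpa using hs
    refine ⟨s, hs', ?_⟩
    rw [← h]; simp [hs']

theorem image_swap {u : Finset B} {x y : B} (hx : x ∈ u) (hy : y ∉ u) :
    u.image (Equiv.swap x y) = insert y (u.erase x) := by
  ext z
  simp only [Finset.mem_image, Finset.mem_insert, Finset.mem_erase]
  constructor
  · rintro ⟨w, hw, rfl⟩
    by_cases h : w = x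
    · subst h; simp
    · have : w ≠ y := fun h => hy (h ▸ hw)
      rw [Equiv.swap_apply_of_ne_of_ne h this]; exact Or.inr ⟨h, hw⟩
  · rintro (rfl | ⟨h, hz⟩)
    · exact ⟨x, hx, by simp⟩
    · have : z ≠ y := fun h => hy (h ▸ hz)
      exact ⟨z, hz, Equiv.swap_apply_of_ne_of_ne h this⟩

theorem img_comp (k : ℕ) (f : ℕ → B) (p : B → B) : img k (p ∘ f) = (img k f).image p := by
  simp [img, Finset.image_image]

theorem step_swap {k : ℕ} {D : Finset (Finset B)} {f : ℕ → B} {u v : Finset B} {x y : B}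
    (hc : u.card = k) (hu : u ∈ D) (hv : v ∈ D) (hx : x ∈ u) (hy : y ∉ u)
    (hvu : v = insert y (u.erase x)) (hf : img k f = u) :
    img k (Equiv.swap x y ∘ f) = v ∧ Step k D f (Equiv.swap x y ∘ f) := by
  have h1 : img k (Equiv.swap x y ∘ f) = v := by rw [img_comp, hf, image_swap hx hy, hvu]
  refine ⟨h1, hf ▸ hu, h1 ▸ hv, ?_⟩
  subst hf
  obtain ⟨t, ht, rfl⟩ := mem_img.1 hx
  refine ⟨t, fun s hs hst => ?_⟩
  have a1 : f s ≠ f t := fun h => hst (img_inj hc hs ht h)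
  have a2 : f s ≠ y := fun h => hy (mem_img.2 ⟨s, hs, h⟩)
  simp [Equiv.swap_apply_of_ne_of_ne a1 a2]

/-- Edge-level connectedness. -/
def Conn (k : ℕ) (D : Finset (Finset B)) (u v : Finset B) : Prop :=
  ∀ f, img k f = u → ∃ g, img k g = v ∧ Reach k D f g

theorem Conn.trans {k : ℕ} {D : Finset (Finset B)} {u v w : Finset B} (h : Conn k D u v)
    (h' : Conn k D v w) : Conn k D u w := by
  intro f hf
  obtain ⟨g, hg, hr⟩ := h f hf
  obtain ⟨g', hg', hr'⟩ := h' g hg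
  exact ⟨g', hg', Relation.ReflTransGen.trans hr hr'⟩

theorem Conn.refl {k : ℕ} {D : Finset (Finset B)} {u : Finset B} : Conn k D u u :=
  fun f hf => ⟨f, hf, Relation.ReflTransGen.refl⟩

theorem conn_adj {k : ℕ} {D : Finset (Finset B)} {m : Finset B} {x y : B}
    (hu : insert x m ∈ D) (hv : insert y m ∈ D) (cu : (insert x m).card = k)
    (hx : x ∉ m) (hy : y ∉ m) : Conn k D (insert x m) (insert y m) := by
  by_cases hxy : x = y
  · subst hxy; exact Conn.refl
  intro f hf
  have := step_swap (x := x) (y := y) cu hu hv (by simp) (by simp [hy, Ne.symm hxy])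
    (by rw [Finset.erase_insert hx]) hf
  exact ⟨_, this.1, Relation.ReflTransGen.single this.2⟩

theorem window_eq (k : ℕ) (w : List B) (x0 : B) (i : ℕ) (h : i + k ≤ w.length) :
    walkEdgeAt k w i = img k (fun j => w.getD (i + j) x0) := by
  ext x
  rw [walkEdgeAt, List.mem_toFinset, mem_img, List.mem_iff_getElem]
  constructor
  · rintro ⟨s, hs, h'⟩
    have hs' : s < k := by simp at hs; omega
    refine ⟨s, hs', ?_⟩
    have : i + s < w.length := by omega
    rw [← h']; simp [this]
  · rintro ⟨s, hs, h'⟩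
    have : i + s < w.length := by omega
    refine ⟨s, by simp; omega, ?_⟩
    rw [← h']; simp [this]

theorem conn_window {k : ℕ} (hk : 1 ≤ k) {D : Finset (Finset B)} (hD : ∀ u ∈ D, u.card = k)
    {W : ℕ → B} {i : ℕ}
    (h1 : img k (fun j => W (i + j)) ∈ D) (h2 : img k (fun j => W (i + 1 + j)) ∈ D) :
    Conn k D (img k (fun j => W (i + j))) (img k (fun j => W (i + 1 + j))) ∧
    Conn k D (img k (fun j => W (i + 1 + j))) (img k (fun j => W (i + j))) := by
  obtain ⟨n, rfl⟩ : ∃ n, k = n + 1 := ⟨k - 1, by omega⟩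
  set m := img n (fun j => W (i + 1 + j)) with hm
  have e1 : img (n + 1) (fun j => W (i + j)) = insert (W i) m := by
    ext x
    simp only [Finset.mem_insert, hm, mem_img]
    constructor
    · rintro ⟨s, hs, rfl⟩
      rcases s with _ | s
      · simp
      · exact Or.inr ⟨s, by omega, by congr 1; omega⟩
    · rintro (rfl | ⟨s, hs, rfl⟩)
      · exact ⟨0, by omega, by simp⟩
      · exact ⟨s + 1, by omega, by congr 1; omega⟩
  have e2 : img (n + 1) (fun j => W (i + 1 + j)) = insert (W (i + 1 + n)) m := by
    simp [img, hm, Finset.range_add_one]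
  have cm : m.card ≤ n := by
    have := Finset.card_image_le (s := Finset.range n) (f := fun j => W (i + 1 + j))
    simpa [hm, img] using this
  rw [e1] at h1 ⊢
  rw [e2] at h2 ⊢
  have hx : W i ∉ m := fun h => by
    have := hD _ h1
    rw [Finset.insert_eq_of_mem h] at this; omega
  have hy : W (i + 1 + n) ∉ m := fun h => by
    have := hD _ h2
    rw [Finset.insert_eq_of_mem h] at this; omega
  exact ⟨conn_adj h1 h2 (hD _ h1) hx hy, conn_adj h2 h1 (hD _ h2) hy hx⟩

theorem conn_of_tight {k : ℕ} (hk : 1 ≤ k) {D : Finset (Finset B)} (hD : ∀ u ∈ D, u.card = k)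
    (hT : TightlyConnected k D) {u v : Finset B} (hu : u ∈ D) (hv : v ∈ D) : Conn k D u v := by
  obtain ⟨x0, _⟩ : u.Nonempty := by
    rw [← Finset.card_pos, hD u hu]; omega
  obtain ⟨w, ⟨hlen, hw⟩, ⟨i, hi, rfl⟩, ⟨j, hj, rfl⟩⟩ := hT u hu v hv
  have key : ∀ n i, i + n + k ≤ w.length →
      Conn k D (walkEdgeAt k w i) (walkEdgeAt k w (i + n)) ∧
      Conn k D (walkEdgeAt k w (i + n)) (walkEdgeAt k w i) := by
    intro n
    induction n with
    | zero => intro i _; exact ⟨Conn.refl, Conn.refl⟩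
    | succ n ih =>
      intro i hi
      obtain ⟨a, b⟩ := ih i (by omega)
      have h1 := hw (i + n) (by omega)
      have h2 := hw (i + n + 1) (by omega)
      have q1 := window_eq k w x0 (i + n) (by omega)
      have q2 := window_eq k w x0 (i + n + 1) (by omega)
      rw [q1] at h1
      rw [q2] at h2
      have := conn_window (W := fun j => w.getD j x0) hk hD h1 h2
      rw [← add_assoc, q2]
      rw [q1] at a b
      exact ⟨a.trans this.1, this.2.trans b⟩
  rcases le_total i j with h | h
  · obtain ⟨n, rfl⟩ := Nat.exists_eq_add_of_le h
    exact (key n i hj).1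
  · obtain ⟨n, rfl⟩ := Nat.exists_eq_add_of_le h
    exact (key n j hi).2

theorem reach_all {k : ℕ} (hk : 1 ≤ k) {D : Finset (Finset B)} (hD : ∀ u ∈ D, u.card = k)
    (hT : TightlyConnected k D) (hs : HasSwitcher D) {f g : ℕ → B} (hf : img k f ∈ D)
    (hg : img k g ∈ D) : Reach k D f g := by
  obtain ⟨e, he, a, ha, hsw⟩ := hs
  -- swap with the central vertex
  have sw1 : ∀ b ∈ e, ∀ f, img k f = e → Reach k D f (Equiv.swap a b ∘ f) := by
    intro b hb f hf
    by_cases hab : a = b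
    · subst hab; simp; exact Relation.ReflTransGen.refl
    obtain ⟨c, hc, h1, h2⟩ := hsw b hb
    have hca : c ≠ a := fun h => hc (h ▸ ha)
    have hcb : c ≠ b := fun h => hc (h ▸ hb)
    have s1 := step_swap (hD e he) he h2 hb hc rfl hf
    have s2 := step_swap (x := a) (y := b) (hD _ h2) h2 h1 (by simp [ha, hab])
      (by simp [Ne.symm hcb]) (by ext z; simp; grind) s1.1
    have s3 := step_swap (x := c) (y := a) (hD _ h1) h1 he (by simp)
      (by simp [Ne.symm hca]) (by ext z; simp; grind) s2.1
    refine (((Relation.ReflTransGen.single s1.2).tail s2.2).tail s3.2).trans ?_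
    refine reach_of_agree (s3.1 ▸ he) ?_
    intro s hs'
    have : f s ≠ c := fun h => hc (hf ▸ mem_img.2 ⟨s, hs', h⟩)
    simp only [Function.comp, Equiv.swap_apply_def]
    grind
  have himg : ∀ x ∈ e, ∀ y ∈ e, ∀ f, img k f = e → img k (Equiv.swap x y ∘ f) = e := by
    intro x hx y hy f hf
    rw [img_comp, hf]
    apply Finset.eq_of_subset_of_card_le
    · intro z hz
      obtain ⟨w, hw, rfl⟩ := Finset.mem_image.1 hz
      rw [Equiv.swap_apply_def]; split_ifs <;> assumption
    · rw [Finset.card_image_of_injective _ (Equiv.injective _)]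
  have sw2 : ∀ x ∈ e, ∀ y ∈ e, ∀ f, img k f = e → Reach k D f (Equiv.swap x y ∘ f) := by
    intro x hx y hy f hf
    by_cases hxy : x = y
    · subst hxy; simp; exact Relation.ReflTransGen.refl
    by_cases hax : a = x
    · subst hax; exact sw1 y hy f hf
    by_cases hay : a = y
    · subst hay; rw [Equiv.swap_comm]; exact sw1 x hx f hf
    have i1 := himg a ha x hx f hf
    have i2 := himg a ha y hy _ i1
    have i3 := himg a ha x hx _ i2
    refine (((sw1 x hx f hf).trans (sw1 y hy _ i1)).trans (sw1 x hx _ i2)).trans ?_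
    refine reach_of_agree (i3 ▸ he) ?_
    intro s hs'
    simp only [Function.comp, Equiv.swap_apply_def]
    grind
  have perm : ∀ f g, img k f = e → img k g = e → Reach k D f g := by
    intro f g hf hg
    have : ∀ n ≤ k, ∃ f', img k f' = e ∧ Reach k D f f' ∧ ∀ s < n, f' s = g s := by
      intro n
      induction n with
      | zero => intro _; exact ⟨f, hf, Relation.ReflTransGen.refl, by simp⟩
      | succ n ih =>
        intro hn
        obtain ⟨f', hf', hr, hag⟩ := ih (by omega)
        have m1 : f' n ∈ e := hf' ▸ mem_img.2 ⟨n, by omega, rfl⟩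
        have m2 : g n ∈ e := hg ▸ mem_img.2 ⟨n, by omega, rfl⟩
        refine ⟨_, himg _ m1 _ m2 f' hf', hr.trans (sw2 _ m1 _ m2 f' hf'), ?_⟩
        intro s hs'
        rcases Nat.lt_succ_iff_lt_or_eq.1 hs' with h | rfl
        · have a1 : f' s ≠ f' n := fun h' => by
            have := img_inj (by rw [hf', hD e he]) (by omega) (by omega) h'
            omega
          have a2 : f' s ≠ g n := fun h' => by
            rw [hag s h] at h'
            have := img_inj (by rw [hg, hD e he]) (by omega) (by omega) h'
            omega
          rw [Function.comp, Equiv.swap_apply_of_ne_of_ne a1 a2, hag s h]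
        · simp
    obtain ⟨f', h1, h2, h3⟩ := this k le_rfl
    exact h2.trans (reach_of_agree (h1 ▸ he) h3)
  obtain ⟨f', hf', hrf⟩ := conn_of_tight hk hD hT hf he f rfl
  obtain ⟨g', hg', hrg⟩ := conn_of_tight hk hD hT hg he g rfl
  exact (hrf.trans (perm f' g' hf' hg')).trans (Reach.symm' hrg)

def cmb (d : ℕ) (s b : ℕ → B) : ℕ → B := fun j => if j < d then s j else b (j - d)

theorem img_cmb_left (d : ℕ) (s b : ℕ → B) : img d (cmb d s b) = img d s :=
  img_congr fun j hj => by simp [cmb, hj]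

theorem cmb_right (d : ℕ) (s b : ℕ → B) : (fun j => cmb d s b (d + j)) = b := by
  funext j; simp [cmb]

theorem img_split {k d : ℕ} (h : d ≤ k) (f : ℕ → B) :
    img k f = img (k - d) (fun j => f (d + j)) ∪ img d f := by
  ext x
  simp only [Finset.mem_union, mem_img]
  constructor
  · rintro ⟨s, hs, rfl⟩
    by_cases hsd : s < d
    · exact Or.inr ⟨s, hsd, rfl⟩
    · exact Or.inl ⟨s - d, by omega, by congr 1; omega⟩
  · rintro (⟨s, hs, rfl⟩ | ⟨s, hs, rfl⟩)
    · exact ⟨d + s, by omega, rfl⟩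
    · exact ⟨s, by omega, rfl⟩

/-- Good placements. -/
def Good (k d : ℕ) (E : Finset (Finset B)) (C : Finset B → Finset (Finset B)) (f : ℕ → B) : Prop :=
  img d f ∈ shadow d E ∧ img (k - d) (fun j => f (d + j)) ∈ C (img d f)

theorem Good.mem {k d : ℕ} (h : d ≤ k) {E : Finset (Finset B)} {C : Finset B → Finset (Finset B)}
    {f : ℕ → B} (hf : Good k d E C f) : img k f ∈ generatedEdges d E C := by
  rw [img_split h]
  simp only [generatedEdges, Finset.mem_biUnion, Finset.mem_image]
  exact ⟨_, hf.1, _, hf.2, rfl⟩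

/-- From a step-sequence of placements to windows. -/
theorem window_mem {k : ℕ} (hk : 1 ≤ k) {H : Finset (Finset B)} {P : ℕ → ℕ → B}
    {m : ℕ} (h0 : img k (P m) ∈ H) (hP : ∀ n < m, Step k H (P n) (P (n + 1))) {i : ℕ}
    (hi : i ≤ m * k) : img k (fun j => P ((i + j) / k) ((i + j) % k)) ∈ H := by
  obtain ⟨q, r, hr, rfl⟩ : ∃ q r, r < k ∧ i = q * k + r :=
    ⟨i / k, i % k, Nat.mod_lt _ hk, (Nat.div_add_mod' i k).symm⟩
  have e1 : ∀ j, r + j < k → P ((q * k + r + j) / k) ((q * k + r + j) % k) = P q (r + j) := by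
    intro j hj
    have : (q * k + r + j) = (r + j) + k * q := by ring
    rw [this, Nat.add_mul_div_left _ _ (by omega), Nat.add_mul_mod_self_left,
      Nat.div_eq_of_lt hj, Nat.mod_eq_of_lt hj]; simp
  have e2 : ∀ j < k, k ≤ r + j →
      P ((q * k + r + j) / k) ((q * k + r + j) % k) = P (q + 1) (r + j - k) := by
    intro j hj hkj
    obtain ⟨z, hz⟩ := Nat.exists_eq_add_of_le hkj
    have : (q * k + r + j) = z + k * (q + 1) := by rw [add_assoc, hz]; ring
    rw [this, Nat.add_mul_div_left _ _ (by omega), Nat.add_mul_mod_self_left,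
      Nat.div_eq_of_lt (by omega), Nat.mod_eq_of_lt (by omega), hz]; simp
  -- the window is a mix of `P q` and `P (q+1)`
  have mix : img k (fun j => P ((q * k + r + j) / k) ((q * k + r + j) % k))
      = img k (fun t => if t < r then P (q + 1) t else P q t) := by
    ext x
    simp only [mem_img]
    constructor
    · rintro ⟨j, hj, rfl⟩
      by_cases h : r + j < k
      · exact ⟨r + j, h, by rw [e1 j h]; simp⟩
      · refine ⟨r + j - k, by omega, ?_⟩
        rw [e2 j hj (by omega), if_pos (by omega)]
    · rintro ⟨t, ht, rfl⟩
      by_cases h : t < r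
      · refine ⟨t + k - r, by omega, ?_⟩
        rw [e2 _ (by omega) (by omega), if_pos h]; congr 1; omega
      · refine ⟨t - r, by omega, ?_⟩
        rw [e1 _ (by omega), if_neg h]; congr 1; omega
  rw [mix]
  rcases Nat.lt_or_ge q m with hq | hq
  · obtain ⟨a, b, t, ht⟩ := hP q hq
    by_cases htr : t < r
    · convert b using 1
      apply img_congr
      intro s hs
      split_ifs with h
      · rfl
      · exact ht s hs (by omega)
    · convert a using 1
      apply img_congr
      intro s hs
      split_ifs with h
      · exact (ht s hs (by omega)).symm
      · rfl
  · have hqm : q = m := by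
      by_contra hne
      have : (m + 1) * k ≤ q * k := Nat.mul_le_mul_right _ (by omega)
      have : (m + 1) * k = m * k + k := by ring
      omega
    subst hqm
    have : r = 0 := by omega
    subst this
    simpa using h0

theorem reach_seq {k : ℕ} {H : Finset (Finset B)} {f g : ℕ → B} (h : Reach k H f g) :
    ∃ (m : ℕ) (P : ℕ → ℕ → B), P 0 = f ∧ P m = g ∧ ∀ n < m, Step k H (P n) (P (n + 1)) := by
  induction h with
  | refl => exact ⟨0, fun _ => f, rfl, rfl, by simp⟩
  | @tail b c _ hbc ih =>
    obtain ⟨m, P, h0, hm, hP⟩ := ih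
    refine ⟨m + 1, fun n => if n ≤ m then P n else c, by simp [h0], by simp, ?_⟩
    intro n hn
    rcases Nat.lt_succ_iff_lt_or_eq.1 hn with h | rfl
    · have h1 : n ≤ m := by omega
      have h2 : n + 1 ≤ m := by omega
      simpa only [h1, h2, if_true] using hP n h
    · simpa [hm] using hbc


theorem mem_shadow {d : ℕ} {E : Finset (Finset B)} {S : Finset B} :
    S ∈ shadow d E ↔ ∃ e ∈ E, S ⊆ e ∧ S.card = d := by
  simp [_root_.shadow, Finset.mem_powersetCard]

theorem link_props {k d : ℕ} {E : Finset (Finset B)} (hE : ∀ e ∈ E, e.card = k) {S u : Finset B}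
    (hS : S ∈ shadow d E) (hu : u ∈ link S E) :
    u.card = k - d ∧ (∀ x ∈ u, x ∉ S) ∧ u ∪ S ∈ E := by
  obtain ⟨e0, _, _, hc⟩ := mem_shadow.1 hS
  simp only [link, Finset.mem_image, Finset.mem_filter] at hu
  obtain ⟨e, ⟨he, hSe⟩, rfl⟩ := hu
  refine ⟨by rw [Finset.card_sdiff_of_subset hSe, hE e he, hc], fun x hx => ?_, ?_⟩
  · exact (Finset.mem_sdiff.1 hx).2
  · rwa [Finset.sdiff_union_of_subset hSe]

section main

variable {k d : ℕ} {E : Finset (Finset B)} {C : Finset B → Finset (Finset B)}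

theorem good_cmb {s b : ℕ → B} (hS : img d s ∈ shadow d E) (hb : img (k - d) b ∈ C (img d s)) :
    Good k d E C (cmb d s b) := by
  refine ⟨by rwa [img_cmb_left], ?_⟩
  rw [cmb_right, img_cmb_left]; exact hb

theorem reach_cmb (hdk : d ≤ k) {s b b' : ℕ → B} (hS : img d s ∈ shadow d E)
    (h : Reach (k - d) (C (img d s)) b b') :
    Reach k (generatedEdges d E C) (cmb d s b) (cmb d s b') := by
  refine Relation.ReflTransGen.lift (cmb d s) ?_ _ _ h
  rintro x y ⟨hx, hy, t, ht⟩
  refine ⟨(good_cmb hS hx).mem hdk, (good_cmb hS hy).mem hdk, d + t, ?_⟩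
  intro j hj hjt
  by_cases h : j < d
  · simp [cmb, h]
  · simp only [cmb, h, if_false]
    exact ht _ (by omega) (by omega)

theorem cmb_self (f : ℕ → B) (j : ℕ) : cmb d f (fun i => f (d + i)) j = f j := by
  simp only [cmb]
  split_ifs with h
  · rfl
  · congr 1; omega

theorem reach_same (hdk : d + 1 ≤ k) (hE : ∀ e ∈ E, e.card = k)
    (hvic : ∀ S ∈ shadow d E, C S ⊆ link S E)
    (hconn : ∀ S ∈ shadow d E, TightlyConnected (k - d) (C S))
    (hsw : ∀ S ∈ shadow d E, HasSwitcher (C S)) {f g : ℕ → B} (hf : Good k d E C f)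
    (hg : Good k d E C g) (hfg : ∀ s < d, f s = g s) :
    Reach k (generatedEdges d E C) f g := by
  have hi := img_congr hfg
  have h1 := reach_all (k := k - d) (by omega)
    (fun u hu => (link_props hE hf.1 (hvic _ hf.1 hu)).1) (hconn _ hf.1) (hsw _ hf.1) hf.2
    (hi ▸ hg.2)
  have h2 := reach_cmb (by omega) hf.1 h1
  refine ((reach_of_agree (hf.mem (by omega)) fun s _ => (cmb_self f s).symm).trans h2).trans ?_
  refine reach_of_agree ?_ ?_
  · exact (good_cmb hf.1 (hi ▸ hg.2)).mem (by omega)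
  · intro s hs
    rw [← cmb_self (d := d) g s]
    simp only [cmb]
    split_ifs with h
    · exact hfg s h
    · rfl

theorem reach_move (hdk : d + 1 ≤ k) (hE : ∀ e ∈ E, e.card = k)
    (hvic : ∀ S ∈ shadow d E, C S ⊆ link S E)
    (hconn : ∀ S ∈ shadow d E, TightlyConnected (k - d) (C S))
    (hint : ∀ S ∈ shadow d E, ∀ S' ∈ shadow d E, (C S ∩ C S').Nonempty)
    (hsw : ∀ S ∈ shadow d E, HasSwitcher (C S)) {f : ℕ → B} (hf : Good k d E C f)
    {u : Finset B} (hu : u ∈ C (img d f)) {b : B} (hb : b ∈ u) {i : ℕ} (hi : i < d) :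
    ∃ f', Good k d E C f' ∧ Reach k (generatedEdges d E C) f f' ∧ f' i = b ∧
      ∀ s < d, s ≠ i → f' s = f s := by
  obtain ⟨_, hdis, huE⟩ := link_props hE hf.1 (hvic _ hf.1 hu)
  obtain ⟨_, _, _, hcS⟩ := mem_shadow.1 hf.1
  have hbS := hdis b hb
  set f2 := Equiv.swap (f i) b ∘ f with hf2
  have f2i : f2 i = b := by simp [hf2]
  have f2s : ∀ s < d, s ≠ i → f2 s = f s := by
    intro s hs hsi
    have a1 : f s ≠ f i := fun h => hsi (img_inj hcS hs hi h)
    have a2 : f s ≠ b := fun h => hbS (mem_img.2 ⟨s, hs, h⟩)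
    simp [hf2, Equiv.swap_apply_of_ne_of_ne a1 a2]
  have hS2 : img d f2 ∈ shadow d E := by
    refine mem_shadow.2 ⟨_, huE, ?_, ?_⟩
    · intro x hx
      obtain ⟨s, hs, rfl⟩ := mem_img.1 hx
      by_cases h : s = i
      · subst h; rw [f2i]; exact Finset.mem_union_left _ hb
      · rw [f2s s hs h]; exact Finset.mem_union_right _ (mem_img.2 ⟨s, hs, rfl⟩)
    · rw [hf2, img_comp, Finset.card_image_of_injective _ (Equiv.injective _), hcS]
  obtain ⟨v, hv⟩ := hint _ hf.1 _ hS2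
  obtain ⟨hv1, hv2⟩ := Finset.mem_inter.1 hv
  have hvc := (link_props hE hf.1 (hvic _ hf.1 hv1)).1
  obtain ⟨β, hβ⟩ := exists_enum v (Finset.card_pos.1 (by omega))
  rw [hvc] at hβ
  have g1 : Good k d E C (cmb d f β) := good_cmb hf.1 (hβ ▸ hv1)
  have g2 : Good k d E C (cmb d f2 β) := good_cmb hS2 (hβ ▸ hv2)
  refine ⟨_, g2, ?_, by simp [cmb, hi, f2i], fun s hs hsi => by simp [cmb, hs, f2s s hs hsi]⟩
  refine (reach_same hdk hE hvic hconn hsw hf g1 fun s hs => by simp [cmb, hs]).tail ?_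
  refine ⟨g1.mem (by omega), g2.mem (by omega), i, fun s hs hsi => ?_⟩
  simp only [cmb]
  split_ifs with h
  · exact (f2s s h hsi).symm
  · rfl

theorem reach_good (hdk : d + 1 ≤ k) (hE : ∀ e ∈ E, e.card = k)
    (hvic : ∀ S ∈ shadow d E, C S ⊆ link S E)
    (hconn : ∀ S ∈ shadow d E, TightlyConnected (k - d) (C S))
    (hint : ∀ S ∈ shadow d E, ∀ S' ∈ shadow d E, (C S ∩ C S').Nonempty)
    (hsw : ∀ S ∈ shadow d E, HasSwitcher (C S)) {f g : ℕ → B} (hf : Good k d E C f)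
    (hg : Good k d E C g) : Reach k (generatedEdges d E C) f g := by
  suffices h : ∀ n ≤ d, ∃ f' g', Good k d E C f' ∧ Good k d E C g' ∧
      Reach k (generatedEdges d E C) f f' ∧ Reach k (generatedEdges d E C) g g' ∧
      ∀ s < n, f' s = g' s by
    obtain ⟨f', g', h1, h2, h3, h4, h5⟩ := h d le_rfl
    exact (h3.trans (reach_same hdk hE hvic hconn hsw h1 h2 h5)).trans (Reach.symm' h4)
  intro n
  induction n with
  | zero => intro _; exact ⟨f, g, hf, hg, .refl, .refl, by simp⟩
  | succ n ih =>
    intro hn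
    obtain ⟨f', g', h1, h2, h3, h4, h5⟩ := ih (by omega)
    obtain ⟨u, hu⟩ := hint _ h1.1 _ h2.1
    obtain ⟨hu1, hu2⟩ := Finset.mem_inter.1 hu
    have huc := (link_props hE h1.1 (hvic _ h1.1 hu1)).1
    obtain ⟨b, hb⟩ := Finset.card_pos.1 (show 0 < u.card by omega)
    obtain ⟨f2, a1, a2, a3, a4⟩ :=
      reach_move hdk hE hvic hconn hint hsw h1 hu1 hb (i := n) (by omega)
    obtain ⟨g2, b1, b2, b3, b4⟩ :=
      reach_move hdk hE hvic hconn hint hsw h2 hu2 hb (i := n) (by omega)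
    refine ⟨f2, g2, a1, b1, h3.trans a2, h4.trans b2, fun s hs => ?_⟩
    rcases Nat.lt_succ_iff_lt_or_eq.1 hs with h | rfl
    · rw [a4 s (by omega) (by omega), b4 s (by omega) (by omega), h5 s h]
    · rw [a3, b3]

theorem exists_good (hdk : d + 1 ≤ k) (hd : 1 ≤ d) (hE : ∀ e ∈ E, e.card = k)
    (hvic : ∀ S ∈ shadow d E, C S ⊆ link S E) {e : Finset B}
    (he : e ∈ generatedEdges d E C) : ∃ f, Good k d E C f ∧ img k f = e := by
  simp only [generatedEdges, Finset.mem_biUnion, Finset.mem_image] at he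
  obtain ⟨S, hS, u, hu, rfl⟩ := he
  have hc := (link_props hE hS (hvic _ hS hu)).1
  obtain ⟨_, _, _, hcS⟩ := mem_shadow.1 hS
  obtain ⟨b, hb⟩ := exists_enum u (Finset.card_pos.1 (by omega))
  obtain ⟨s, hs⟩ := exists_enum S (Finset.card_pos.1 (by omega))
  rw [hc] at hb
  rw [hcS] at hs
  have hg : Good k d E C (cmb d s b) := good_cmb (hs.symm ▸ hS) (by rw [hs, hb]; exact hu)
  refine ⟨_, hg, ?_⟩
  rw [img_split (by omega : d ≤ k), cmb_right, img_cmb_left, hb, hs]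

theorem window_map (k : ℕ) (W : ℕ → B) {n i : ℕ} (h : i + k ≤ n) :
    walkEdgeAt k ((List.range n).map W) i = img k (fun j => W (i + j)) := by
  rw [window_eq k _ (W 0) i (by simpa using h)]
  apply img_congr
  intro s hs
  have : i + s < n := by omega
  simp [this]

theorem take_drop_toFinset (l : List B) (x0 : B) (i n : ℕ) (h : i + n ≤ l.length) :
    ((l.drop i).take n).toFinset = img n (fun j => l.getD (i + j) x0) :=
  window_eq n l x0 i h

end main

end GenConn

open GenConn

/-- connectivity and divisibility of the graph generated by a vicinity. -/
theorem generated_connectivity_divisibility {B : Type*} [DecidableEq B] (k d : ℕ)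
    (hd : 1 ≤ d) (hdk : d ≤ k - 1) (V : Finset B) (E : Finset (Finset B))
    (hE : ∀ e ∈ E, e ⊆ V ∧ e.card = k)
    (C : Finset B → Finset (Finset B))
    (hvic : ∀ S ∈ shadow d E, C S ⊆ link S E)
    (hconn : ∀ S ∈ shadow d E, TightlyConnected (k - d) (C S))
    (hint : ∀ S ∈ shadow d E, ∀ S' ∈ shadow d E, (C S ∩ C S').Nonempty)
    (hsw : ∀ S ∈ shadow d E, HasSwitcher (C S))
    (harc : HasArc k d E C) :
    TightlyConnected k (generatedEdges d E C) ∧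
      ∃ w : List B, IsClosedTightWalk k (generatedEdges d E C) w ∧ w.length % k = 1 % k := by
  have hdk' : d + 1 ≤ k := by omega
  have hE' : ∀ e ∈ E, e.card = k := fun e he => (hE e he).2
  refine ⟨?_, ?_⟩
  · intro e₁ h₁ e₂ h₂
    obtain ⟨f, hf, rfl⟩ := exists_good hdk' hd hE' hvic h₁
    obtain ⟨g, hg, rfl⟩ := exists_good hdk' hd hE' hvic h₂
    obtain ⟨m, P, hP0, hPm, hP⟩ := reach_seq (reach_good hdk' hE' hvic hconn hint hsw hf hg)
    have hm1 : (m + 1) * k = m * k + k := by ring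
    refine ⟨(List.range ((m + 1) * k)).map (fun n => P (n / k) (n % k)), ⟨?_, ?_⟩, ⟨0, ?_, ?_⟩,
      ⟨m * k, ?_, ?_⟩⟩
    · simp only [List.length_map, List.length_range]; omega
    · intro i hi
      simp only [List.length_map, List.length_range] at hi
      rw [window_map k _ hi]
      exact window_mem (by omega) (hPm ▸ h₂) hP (by omega)
    · simp only [List.length_map, List.length_range]; omega
    · rw [window_map k _ (by omega)]
      apply img_congr
      intro s hs
      simp [Nat.div_eq_of_lt hs, Nat.mod_eq_of_lt hs, hP0]
    · simp only [List.length_map, List.length_range]; omega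
    · rw [window_map k _ (by omega)]
      apply img_congr
      intro s hs
      have : m * k + s = s + k * m := by ring
      simp only [this, Nat.add_mul_div_left _ _ (show 0 < k by omega), Nat.add_mul_mod_self_left,
        Nat.div_eq_of_lt hs, Nat.mod_eq_of_lt hs, Nat.zero_add, hPm]
  · obtain ⟨l, hlen, hnd, a1, a2, a3, a4⟩ := harc
    obtain ⟨x0, hx0⟩ : ∃ x0, l.getD 0 x0 = l.getD 0 x0 := by
      cases l with
      | nil => simp at hlen
      | cons x _ => exact ⟨x, rfl⟩
    have t1 : (l.take d).toFinset = img d (fun j => l.getD j x0) := by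
      simpa using take_drop_toFinset l x0 0 d (by omega)
    have t2 := take_drop_toFinset l x0 d (k - d) (by omega)
    have t3 := take_drop_toFinset l x0 1 d (by omega)
    have t4 : (l.drop (d + 1)).toFinset = img (k - d) (fun j => l.getD (d + 1 + j) x0) := by
      rw [← take_drop_toFinset l x0 (d + 1) (k - d) (by omega), List.take_of_length_le]
      simp; omega
    rw [t1] at a1
    rw [t1, t2] at a2
    rw [t3] at a3
    rw [t3, t4] at a4
    have hg : Good k d E C (fun j => l.getD j x0) := ⟨a1, a2⟩
    have hf : Good k d E C (fun j => l.getD (1 + j) x0) := by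
      refine ⟨a3, ?_⟩
      convert a4 using 4
      omega
    obtain ⟨m, P, hP0, hPm, hP⟩ := reach_seq (reach_good hdk' hE' hvic hconn hint hsw hf hg)
    have hm : 1 ≤ m := by
      by_contra hm
      obtain rfl : m = 0 := by omega
      have h := congrFun (hP0.symm.trans hPm) 0
      simp only [Nat.add_zero] at h
      rw [List.getD_eq_getElem _ _ (by omega), List.getD_eq_getElem _ _ (by omega)] at h
      have := (hnd.getElem_inj_iff).1 h
      omega
    have hmk : k ≤ m * k := Nat.le_mul_of_pos_left k hm
    refine ⟨(List.range (m * k + 1)).map (fun n => P (n / k) (n % k)), ⟨?_, ?_⟩, ?_⟩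
    · simp only [List.length_map, List.length_range]; omega
    · intro i hi
      simp only [List.length_map, List.length_range] at hi
      have hw := window_mem (by omega) (hPm ▸ hg.mem (by omega)) hP (show i ≤ m * k by omega)
      convert hw using 1
      have := window_eq k (((List.range (m * k + 1)).map (fun n => P (n / k) (n % k))).rotate i)
        x0 0 (by simp only [List.length_rotate, List.length_map, List.length_range]; omega)
      rw [walkEdgeAt, List.drop_zero] at this
      rw [this]
      apply img_congr
      intro s hs
      rw [List.getD_eq_getElem _ _ (by
        simp only [List.length_rotate, List.length_map, List.length_range]; omega),
        List.getElem_rotate]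
      simp only [List.length_map, List.length_range, List.getElem_map, List.getElem_range,
        Nat.zero_add]
      by_cases h : i + s < m * k + 1
      · rw [Nat.add_comm s i, Nat.mod_eq_of_lt h]
      · obtain ⟨t, ht⟩ := Nat.exists_eq_add_of_le (not_lt.1 h)
        have htk : t + 1 < k := by omega
        have e1 : (s + i) % (m * k + 1) = t := by
          rw [Nat.add_comm s i, ht, Nat.add_mod_left, Nat.mod_eq_of_lt (by omega)]
        have e2 : i + s = (t + 1) + k * m := by rw [ht]; ring
        rw [e1, e2, Nat.add_mul_div_left _ _ (show 0 < k by omega), Nat.add_mul_mod_self_left,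
          Nat.div_eq_of_lt htk, Nat.mod_eq_of_lt htk, Nat.zero_add, hPm,
          Nat.div_eq_of_lt (by omega : t < k), Nat.mod_eq_of_lt (by omega : t < k), hP0]
        exact congrArg (fun z => l.getD z x0) (Nat.add_comm 1 t)
    · simp [Nat.add_mod]
end

section
/- (Space lemma.) Let 1 ≤ d ≤ k−1. There exists c > 0 depending only on k such that for all 0 < α ≤ c, 0 < γ ≤ c and all δ > 0 the following holds. Let R be a k-graph on t vertices with α-perturbed minimum relative d-degree at least δ and no isolated vertices, and let (C_S) be a d-vicinity in R such that every C_S has a fractional matching of size at least (1/k + γ)·t. Then the k-graph generated by the vicinity is γ-robustly matchable. -/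
open Finset

variable {A : Type*} [DecidableEq A]

theorem sl_step (r p c : ℝ) (hr : 0 < r) (hp : p < 0) (hc : 0 < c) :
    ∃ s, 0 < s ∧ s ≤ r ∧ 2 * s * p + s ^ 2 * c < 0 := by
  refine ⟨min r (-p / c), lt_min hr (div_pos (by linarith) hc), min_le_left _ _, ?_⟩
  have h1 : min r (-p / c) * c ≤ -p := by
    have := min_le_right r (-p / c)
    rwa [le_div_iff₀ hc] at this
  have h0 : 0 < min r (-p / c) := lt_min hr (div_pos (by linarith) hc)
  nlinarith

theorem sl_farkas {A : Type*} [DecidableEq A] (V : Finset A) (H : Finset (Finset A))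
    (hH : ∀ e ∈ H, e ⊆ V ∧ e.Nonempty) (b : A → ℝ) (hb : ∀ v ∈ V, 0 ≤ b v ∧ b v ≤ 1)
    (hy : ∀ y : A → ℝ, (∀ e ∈ H, 0 ≤ ∑ v ∈ e, y v) → 0 ≤ ∑ v ∈ V, b v * y v) :
    ∃ w : Finset A → ℝ, (∀ e, 0 ≤ w e) ∧
      ∀ v ∈ V, ∑ e ∈ H.filter (fun e' => v ∈ e'), w e = b v := by
  set D : (Finset A → ℝ) → A → ℝ :=
    fun w v => ∑ e ∈ H.filter (fun e' => v ∈ e'), w e - b v with hD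
  set F : (Finset A → ℝ) → ℝ := fun w => ∑ v ∈ V, (D w v) ^ 2 with hF
  set N : ℝ := (V.card : ℝ) + 3 with hN
  have hN0 : (0 : ℝ) ≤ N := by positivity
  have hcomp : IsCompact (Set.pi Set.univ (fun _ : Finset A => Set.Icc (0 : ℝ) N)) :=
    isCompact_univ_pi (fun _ => isCompact_Icc)
  have hcont : Continuous F := by
    simp only [hF, hD]; fun_prop
  obtain ⟨w, hw, hmin⟩ := hcomp.exists_isMinOn
    ⟨fun _ => 0, fun _ _ => ⟨le_rfl, hN0⟩⟩ hcont.continuousOn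
  have hw0 : ∀ e, 0 ≤ w e := fun e => (hw e trivial).1
  have hmin' : ∀ w' : Finset A → ℝ, (∀ e, 0 ≤ w' e ∧ w' e ≤ N) → F w ≤ F w' :=
    fun w' h => hmin (fun e _ => h e)
  have hFt : F w ≤ V.card := by
    refine (hmin' (fun _ => 0) (fun e => ⟨le_rfl, hN0⟩)).trans ?_
    calc F (fun _ => 0) ≤ ∑ v ∈ V, (1 : ℝ) := by
          refine Finset.sum_le_sum fun v hv => ?_
          simp only [hD, Finset.sum_const_zero, zero_sub]
          nlinarith [hb v hv]
      _ = V.card := by simp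
  have hlt : ∀ e ∈ H, w e ≤ V.card + 2 := by
    intro e he
    obtain ⟨v, hv⟩ := (hH e he).2
    have hvV := (hH e he).1 hv
    have h1 : w e ≤ ∑ e ∈ H.filter (fun e' => v ∈ e'), w e :=
      Finset.single_le_sum (f := w) (fun i _ => hw0 i) (by simp [he, hv])
    have h2 : (D w v) ^ 2 ≤ F w :=
      Finset.single_le_sum (f := fun v => (D w v) ^ 2) (fun i _ => sq_nonneg _) hvV
    have h3 : D w v = ∑ e ∈ H.filter (fun e' => v ∈ e'), w e - b v := rfl
    have h4 := (hb v hvV).2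
    have h5 : (0 : ℝ) ≤ V.card := by positivity
    have h6 : D w v ≤ V.card + 1 := by
      by_contra hcon
      push Not at hcon
      nlinarith
    linarith
  have hpert : ∀ e ∈ H, ∀ s : ℝ, F (fun e' => w e' + if e' = e then s else 0)
      = F w + (2 * s * (∑ v ∈ e, D w v) + s ^ 2 * (e.card : ℝ)) := by
    intro e he s
    have hDv : ∀ v, D (fun e' => w e' + if e' = e then s else 0) v
        = D w v + if v ∈ e then s else 0 := by
      intro v
      simp only [hD, Finset.sum_add_distrib, Finset.sum_ite_eq', Finset.mem_filter, he, true_and]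
      ring
    simp only [hF, hDv]
    have : ∀ v, (D w v + if v ∈ e then s else 0) ^ 2
        = (D w v) ^ 2 + (if v ∈ e then (2 * s * D w v + s ^ 2) else 0) := by
      intro v; split_ifs <;> ring
    simp only [this, Finset.sum_add_distrib, Finset.sum_ite_mem,
      Finset.inter_eq_right.2 (hH e he).1, Finset.mul_sum]
    simp; ring
  have hcard : ∀ e ∈ H, (0 : ℝ) < e.card := fun e he => by
    exact_mod_cast Finset.card_pos.2 (hH e he).2
  have hge : ∀ e ∈ H, 0 ≤ ∑ v ∈ e, D w v := by
    intro e he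
    by_contra hneg
    push Not at hneg
    obtain ⟨s, hs0, hs1, hs2⟩ := sl_step 1 _ _ one_pos hneg (hcard e he)
    have := hmin' (fun e' => w e' + if e' = e then s else 0) (by
      intro e'
      have := hw e' trivial
      have h1 := hw0 e'
      have h2 : w e' ≤ N := this.2
      split_ifs with h
      · subst h
        have := hlt e' he
        constructor <;> linarith
      · constructor <;> linarith)
    rw [hpert e he] at this
    linarith
  have hzero : ∀ e ∈ H, w e * ∑ v ∈ e, D w v = 0 := by
    intro e he
    by_contra hne
    have hwe : 0 < w e := lt_of_le_of_ne (hw0 e) (by rintro h; simp [← h] at hne)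
    have hye : 0 < ∑ v ∈ e, D w v :=
      lt_of_le_of_ne (hge e he) (by rintro h; simp [← h] at hne)
    obtain ⟨s, hs0, hs1, hs2⟩ := sl_step (w e) (-∑ v ∈ e, D w v) _ hwe (by linarith) (hcard e he)
    have := hmin' (fun e' => w e' + if e' = e then -s else 0) (by
      intro e'
      have h1 := hw0 e'
      have h2 : w e' ≤ N := (hw e' trivial).2
      split_ifs with h
      · subst h
        constructor <;> linarith
      · constructor <;> linarith)
    rw [hpert e he] at this
    nlinarith
  have hsum : ∑ v ∈ V, b v * D w v = - F w := by
    have h1 : ∀ v, b v * D w v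
        = (∑ e ∈ H, if v ∈ e then w e * D w v else 0) - (D w v) ^ 2 := by
      intro v
      have : b v = ∑ e ∈ H.filter (fun e' => v ∈ e'), w e - D w v := by simp [hD]
      rw [← Finset.sum_filter, ← Finset.sum_mul]
      rw [this]; ring
    simp only [h1, Finset.sum_sub_distrib]
    rw [Finset.sum_comm]
    have h2 : ∀ e ∈ H, (∑ v ∈ V, if v ∈ e then w e * D w v else 0) = 0 := by
      intro e he
      rw [Finset.sum_ite_mem, Finset.inter_eq_right.2 (hH e he).1, ← Finset.mul_sum, hzero e he]
    rw [Finset.sum_congr rfl h2]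
    simp [hF]
  have hfin := hy (D w) hge
  rw [hsum] at hfin
  refine ⟨w, hw0, fun v hv => ?_⟩
  have h2 : (D w v) ^ 2 ≤ F w :=
      Finset.single_le_sum (f := fun v => (D w v) ^ 2) (fun i _ => sq_nonneg _) hv
  have h3 : D w v = 0 := by
    have : (D w v) ^ 2 = 0 := le_antisymm (by linarith) (sq_nonneg _)
    simpa using this
  simp only [hD] at h3
  linarith

theorem sl_transport {A : Type*} [DecidableEq A] (V S bad : Finset A) (v1 : A)
    (hSV : S ⊆ V) (hv1 : v1 ∈ S) (y b g : A → ℝ) (q : ℝ)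
    (hbad : bad ⊆ V)
    (hymin : ∀ v ∈ V, y v1 ≤ y v)
    (hgood : ∀ x ∈ V, x ∉ S → x ∉ bad → ∀ s ∈ S, y s ≤ y x)
    (hb : ∀ v ∈ V, b v ≤ 1) (hg0 : ∀ v ∈ V, 0 ≤ g v) (hgb : ∀ v ∈ V, g v ≤ b v)
    (hq : 1 + (bad.card : ℝ) ≤ q)
    (hsum : ∑ v ∈ V, b v = S.card * q + ∑ v ∈ V, g v) :
    q * ∑ v ∈ S, y v + ∑ v ∈ V, g v * y v ≤ ∑ v ∈ V, b v * y v := by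
  obtain ⟨x0, hx0, hM⟩ := S.exists_max_image y ⟨v1, hv1⟩
  set M := y x0 with hMdef
  set h : A → ℝ := fun v => b v - g v - if v ∈ S then q else 0 with hh
  have hS : ∀ f : A → ℝ, ∑ v ∈ V, (if v ∈ S then f v else 0) = ∑ v ∈ S, f v := by
    intro f
    rw [Finset.sum_ite_mem, Finset.inter_eq_right.2 hSV]
  have hhsum : ∑ v ∈ V, h v = 0 := by
    simp only [hh, Finset.sum_sub_distrib, hS (fun _ => q), hsum]
    simp
  have hhy : ∑ v ∈ V, h v * y v
      = ∑ v ∈ V, b v * y v - ∑ v ∈ V, g v * y v - q * ∑ v ∈ S, y v := by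
    simp only [hh, sub_mul, Finset.sum_sub_distrib, ite_mul, zero_mul, hS (fun v => q * y v),
      Finset.mul_sum]
  have hhM : ∑ v ∈ V, h v * (y v - M) = ∑ v ∈ V, h v * y v := by
    simp only [mul_sub, Finset.sum_sub_distrib, ← Finset.sum_mul, hhsum]; simp
  have hD : 0 ≤ M - y v1 := by linarith [hM v1 hv1]
  have hbc : (0 : ℝ) ≤ bad.card := by positivity
  have hterm : ∀ v ∈ V, (if v = v1 then (bad.card : ℝ) * (M - y v1) else 0)
      - (if v ∈ bad then (M - y v1) else 0) ≤ h v * (y v - M) := by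
    intro v hv
    have e1 := hb v hv
    have e2 := hg0 v hv
    have e3 := hgb v hv
    have e4 := hymin v hv
    by_cases hvS : v ∈ S
    · have e5 := hM v hvS
      have hv' : h v = b v - g v - q := by simp [hh, hvS]
      have hb0 : 0 ≤ (if v ∈ bad then (M - y v1) else 0) := by split_ifs <;> linarith
      by_cases h1 : v = v1
      · subst h1
        simp only [if_true]
        have : (bad.card : ℝ) * (M - y v) ≤ (-h v) * (M - y v) :=
          mul_le_mul_of_nonneg_right (by linarith) hD
        linarith
      · simp only [h1, if_false]
        have : 0 ≤ (-h v) * (M - y v) := mul_nonneg (by linarith) (by linarith)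
        linarith
    · have hv' : h v = b v - g v := by simp [hh, hvS]
      have h1 : v ≠ v1 := by rintro rfl; exact hvS hv1
      simp only [h1, if_false]
      by_cases hvb : v ∈ bad
      · simp only [hvb, if_true]
        have a1 : h v * (M - y v) ≤ h v * (M - y v1) :=
          mul_le_mul_of_nonneg_left (by linarith) (by linarith)
        have a2 : h v * (M - y v1) ≤ 1 * (M - y v1) :=
          mul_le_mul_of_nonneg_right (by linarith) hD
        linarith
      · simp only [hvb, if_false]
        have := hgood v hv hvS hvb x0 hx0
        have : 0 ≤ h v * (y v - M) := mul_nonneg (by linarith) (by linarith)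
        linarith
  have hfin := Finset.sum_le_sum hterm
  rw [Finset.sum_sub_distrib, Finset.sum_ite_eq' , if_pos (hSV hv1), Finset.sum_ite_mem,
    Finset.inter_eq_right.2 hbad, Finset.sum_const, nsmul_eq_mul, sub_self, hhM, hhy] at hfin
  linarith

theorem sl_greedy {A : Type*} [DecidableEq A] (k d : ℕ) (a δ : ℝ) (ha : 0 < a) (ha1 : a ≤ 1)
    (V : Finset A) (E : Finset (Finset A)) (hE : ∀ e ∈ E, e ⊆ V ∧ e.card = k)
    (hP : PerturbedDegLB k d a δ V E) (hiso : ∀ v ∈ V, ∃ e ∈ E, v ∈ e)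
    (y : A → ℝ) (v1 : A) (hv1 : v1 ∈ V) (n : ℕ) (hn : n + 1 ≤ d) :
    ∃ S ∈ shadow (n + 1) E, ∃ bad : Finset A, bad ⊆ V ∧ v1 ∈ S ∧ 
      ((∀ v ∈ V, y v1 ≤ y v) → ∀ x ∈ V, x ∉ S → x ∉ bad → ∀ s ∈ S, y s ≤ y x) ∧
      (bad.card : ℝ) ≤ n * (a * V.card) ∧ (a * V.card ≤ 1 → bad = ∅) := by
  induction n with
  | zero =>
    obtain ⟨e, he, hve⟩ := hiso v1 hv1
    refine ⟨{v1}, ?_, ∅, by simp, by simp, ?_, by simp, by simp⟩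
    · simp only [_root_.shadow, Finset.mem_biUnion, Finset.mem_powersetCard]
      exact ⟨e, he, by simpa using hve, by simp⟩
    · intro h x hx _ _ s hs
      rw [Finset.mem_singleton.1 hs]; exact h x hx
  | succ n ih =>
    obtain ⟨S, hS, bad, hbV, h1S, hgood, hbc, hb0⟩ := ih (by omega)
    have hS' := hS
    simp only [_root_.shadow, Finset.mem_biUnion, Finset.mem_powersetCard] at hS'
    obtain ⟨e, he, hSe, hScard⟩ := hS'
    have hSV : S ⊆ V := hSe.trans (hE e he).1
    have h3 := (hP (n + 2) (by omega) hn).2.2 S (Or.inl hS)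
    set N := (V \ S).filter (fun x => insert x S ∉ shadow (n + 2) E) with hNdef
    have hNc : (N.card : ℝ) < a * ((V.card : ℝ) - (n + 1)) := by
      refine lt_of_le_of_lt ?_ (h3.trans_eq (by push_cast; ring))
      norm_cast
      refine Finset.card_le_card_of_injOn (fun x => insert x S) ?_ ?_
      · intro x hx
        simp only [hNdef, Finset.coe_filter, Finset.mem_sdiff, Set.mem_setOf_eq] at hx
        simp only [Finset.coe_filter, Finset.mem_powersetCard, Set.mem_setOf_eq]
        refine ⟨⟨Finset.insert_subset hx.1.1 hSV, ?_⟩, Finset.subset_insert _ _, hx.2⟩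
        rw [Finset.card_insert_of_notMem hx.1.2, hScard]
      · intro x hx z hz hxz
        simp only [hNdef, Finset.coe_filter, Finset.mem_sdiff, Set.mem_setOf_eq] at hx hz
        have : x ∈ insert z S := by rw [← show insert x S = insert z S from hxz]; simp
        rcases Finset.mem_insert.1 this with h | h
        · exact h
        · exact absurd h hx.1.2
    have hVS : ((V \ S).card : ℝ) = (V.card : ℝ) - (n + 1) := by
      rw [Finset.card_sdiff_of_subset hSV, Nat.cast_sub (Finset.card_le_card hSV), hScard]
      push_cast; ring
    have hNV : N ⊆ V \ S := Finset.filter_subset _ _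
    have hne : ((V \ S) \ N).Nonempty := by
      rw [Finset.sdiff_nonempty]
      intro hsub
      have : ((V \ S).card : ℝ) ≤ N.card := by exact_mod_cast Finset.card_le_card hsub
      have h0 : (0 : ℝ) ≤ (V \ S).card := by positivity
      rw [hVS] at this h0
      nlinarith
    obtain ⟨x, hx, hxmin⟩ := Finset.exists_min_image _ y hne
    simp only [Finset.mem_sdiff] at hx hxmin
    have hxs : insert x S ∈ shadow (n + 2) E := by
      by_contra hcon
      exact hx.2 (by simp [hNdef, hx.1, hcon])
    have hNt : (N.card : ℝ) ≤ a * V.card := by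
      have : (0 : ℝ) ≤ n := by positivity
      nlinarith
    refine ⟨insert x S, hxs, bad ∪ N, Finset.union_subset hbV (hNV.trans Finset.sdiff_subset),
      by simp [h1S], ?_, ?_, ?_⟩
    · intro hm z hz hzS hzb s hs
      simp only [Finset.mem_insert, Finset.mem_union, not_or] at hzS hzb hs
      rcases hs with rfl | hs
      · exact hxmin z ⟨⟨hz, hzS.2⟩, hzb.2⟩
      · exact hgood hm z hz hzS.2 hzb.1 s hs
    · have : ((bad ∪ N).card : ℝ) ≤ bad.card + N.card := by
        exact_mod_cast Finset.card_union_le _ _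
      push_cast
      linarith
    · intro hat
      have : N.card = 0 := by
        have : (N.card : ℝ) < 1 := by
          have : (0 : ℝ) ≤ n := by positivity
          nlinarith
        have : N.card < 1 := by exact_mod_cast this
        omega
      rw [hb0 hat, Finset.card_eq_zero.1 this]; simp

set_option maxHeartbeats 2000000 in
/-- Space lemma. -/
theorem space_lemma (k d : ℕ) (hk : 2 ≤ k) (hd : 1 ≤ d) (hdk : d ≤ k - 1) :
    ∃ c : ℝ, 0 < c ∧ ∀ a γ : ℝ, 0 < a → a ≤ c → 0 < γ → γ ≤ c → ∀ δ : ℝ, 0 < δ →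
      ∀ (B : Type) [DecidableEq B], ∀ (V : Finset B) (E : Finset (Finset B)),
        (∀ e ∈ E, e ⊆ V ∧ e.card = k) →
        PerturbedDegLB k d a δ V E →
        (∀ v ∈ V, ∃ e ∈ E, v ∈ e) →
        ∀ C : Finset B → Finset (Finset B),
          (∀ S ∈ shadow d E, C S ⊆ link S E) →
          (∀ S ∈ shadow d E, HasFracMatching (C S) ((1 / (k : ℝ) + γ) * (V.card : ℝ))) →
          RobustlyMatchable γ V (generatedEdges d E C) := by
  have hkR : (2 : ℝ) ≤ k := by exact_mod_cast hk
  have hdk1 : (d : ℝ) + 1 ≤ k := by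
    have : d + 1 ≤ k := by omega
    exact_mod_cast this
  have hdR : (1 : ℝ) ≤ d := by exact_mod_cast hd
  refine ⟨1 / (2 * (k : ℝ) ^ 2), by positivity, ?_⟩
  intro a γ ha hac hγ hγc δ hδ B _ V E hE hP hiso C hC hM b hb
  have hac' : a * (2 * (k : ℝ) ^ 2) ≤ 1 := by rwa [le_div_iff₀ (by positivity)] at hac
  have hγc' : γ * (2 * (k : ℝ) ^ 2) ≤ 1 := by rwa [le_div_iff₀ (by positivity)] at hγc
  have hγk : γ * (2 * k) ≤ 1 / 2 := by nlinarith
  have ha1 : a ≤ 1 := by nlinarith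
  have hγ2 : γ ≤ 1 / 2 := by nlinarith
  have hlink : ∀ S ∈ shadow d E, ∀ X ∈ C S, X ∪ S ∈ E ∧ Disjoint X S := by
    intro S hS X hX
    have := hC S hS hX
    simp only [link, Finset.mem_image, Finset.mem_filter] at this
    obtain ⟨e, ⟨he, hSe⟩, rfl⟩ := this
    rw [Finset.sdiff_union_of_subset hSe]
    exact ⟨he, Finset.sdiff_disjoint⟩
  have hH : ∀ e ∈ generatedEdges d E C, e ∈ E := by
    intro e he
    simp only [generatedEdges, Finset.mem_biUnion, Finset.mem_image] at he
    obtain ⟨S, hS, X, hX, rfl⟩ := he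
    exact (hlink S hS X hX).1
  have hHne : ∀ e ∈ generatedEdges d E C, e ⊆ V ∧ e.Nonempty := by
    intro e he
    have := hE e (hH e he)
    exact ⟨this.1, Finset.card_pos.1 (by omega)⟩
  have key : ∀ y : B → ℝ, (∀ e ∈ generatedEdges d E C, 0 ≤ ∑ v ∈ e, y v) →
      0 ≤ ∑ v ∈ V, b v * y v := by
    intro y hy
    rcases V.eq_empty_or_nonempty with rfl | hVne
    · simp
    obtain ⟨v1, hv1, hv1min⟩ := V.exists_min_image y hVne
    obtain ⟨n, rfl⟩ : ∃ n, d = n + 1 := ⟨d - 1, by omega⟩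
    obtain ⟨S, hS, bad, hbV, h1S, hgood, hbc, hb0⟩ :=
      sl_greedy k (n + 1) a δ ha ha1 V E hE hP hiso y v1 hv1 n le_rfl
    have hS' := hS
    simp only [_root_.shadow, Finset.mem_biUnion, Finset.mem_powersetCard] at hS'
    obtain ⟨e, he, hSe, hScard⟩ := hS'
    have hSV : S ⊆ V := hSe.trans (hE e he).1
    obtain ⟨w, hw, hwv, hwm⟩ := hM S hS
    set W := ∑ X ∈ C S, w X with hW
    set u : B → ℝ := fun v => ∑ X ∈ (C S).filter (fun e' => v ∈ e'), w X with hu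
    have hu0 : ∀ v, 0 ≤ u v := fun v =>
      Finset.sum_nonneg fun X hX => (hw X (Finset.mem_filter.1 hX).1).1
    have hXV : ∀ X ∈ C S, X ⊆ V := fun X hX =>
      Finset.subset_union_left.trans (hE _ (hlink S hS X hX).1).1
    have hXc : ∀ X ∈ C S, (X.card : ℝ) = k - S.card := by
      intro X hX
      have h1 := (hE _ (hlink S hS X hX).1).2
      rw [Finset.card_union_of_disjoint (hlink S hS X hX).2] at h1
      rw [← h1]; push_cast; ring
    have huS : ∀ v ∈ S, u v = 0 := by
      intro v hv
      refine Finset.sum_eq_zero fun X hX => ?_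
      rw [Finset.mem_filter] at hX
      exact absurd hv (Finset.disjoint_left.1 (hlink S hS X hX.1).2 hX.2)
    have hswap : ∀ f : B → ℝ, ∑ v ∈ V, u v * f v = ∑ X ∈ C S, w X * ∑ v ∈ X, f v := by
      intro f
      have h1 : ∀ v, u v * f v = ∑ X ∈ C S, if v ∈ X then w X * f v else 0 := by
        intro v
        rw [← Finset.sum_filter, ← Finset.sum_mul]
      simp only [h1]
      rw [Finset.sum_comm]
      refine Finset.sum_congr rfl fun X hX => ?_
      rw [Finset.sum_ite_mem, Finset.inter_eq_right.2 (hXV X hX), Finset.mul_sum]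
    have husum : ∑ v ∈ V, u v = (k - S.card) * W := by
      have := hswap (fun _ => 1)
      simp only [mul_one, Finset.sum_const, nsmul_eq_mul] at this
      rw [this, Finset.sum_congr rfl (fun X hX => by rw [hXc X hX]), ← Finset.sum_mul]
      ring
    have hmain : 0 ≤ W * ∑ v ∈ S, y v + ∑ v ∈ V, u v * y v := by
      rw [hswap, hW, Finset.sum_mul, ← Finset.sum_add_distrib]
      refine Finset.sum_nonneg fun X hX => ?_
      rw [← mul_add]
      refine mul_nonneg (hw X hX).1 ?_
      rw [add_comm, ← Finset.sum_union (hlink S hS X hX).2]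
      refine hy _ ?_
      simp only [generatedEdges, Finset.mem_biUnion, Finset.mem_image]
      exact ⟨S, hS, X, hX, rfl⟩
    have hSd : (S.card : ℝ) = ((n + 1 : ℕ) : ℝ) := by rw [hScard]
    set dr : ℝ := ((n + 1 : ℕ) : ℝ) with hdr
    set t : ℝ := (V.card : ℝ) with ht
    have ht0 : 0 < t := by
      rw [ht]; exact_mod_cast hVne.card_pos
    have hkW : (1 + k * γ) * t ≤ k * W := by
      have h1 : (k : ℝ) * ((1 / (k : ℝ) + γ) * t) ≤ k * W :=
        mul_le_mul_of_nonneg_left hwm (by linarith)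
      have h2 : (k : ℝ) * ((1 / (k : ℝ) + γ) * t) = (1 + k * γ) * t := by
        field_simp
      linarith
    have hkγt : 0 < k * γ * t := by positivity
    have hW0 : 0 < W := by nlinarith
    have hule : ∑ v ∈ V, u v ≤ t - dr := by
      have h1 : ∑ v ∈ V, u v ≤ ∑ v ∈ V, ((1 : ℝ) - if v ∈ S then 1 else 0) := by
        refine Finset.sum_le_sum fun v hv => ?_
        split_ifs with h
        · rw [huS v h]; simp
        · have := hwv v
          simp only [hu]; linarith
      rw [Finset.sum_sub_distrib, Finset.sum_ite_mem, Finset.inter_eq_right.2 hSV] at h1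
      simp only [Finset.sum_const, nsmul_eq_mul, mul_one] at h1
      rw [hSd] at h1
      exact h1
    have htk : (k : ℝ) < t := by
      rw [husum, hSd] at hule
      have h1 : (k - dr) * t < (k - dr) * (k * W) :=
        mul_lt_mul_of_pos_left (by linarith) (by linarith)
      have h2 : k * ((k - dr) * W) ≤ k * (t - dr) :=
        mul_le_mul_of_nonneg_left hule (by linarith)
      have h3 : dr * k < dr * t := by linarith
      exact lt_of_mul_lt_mul_left h3 (by linarith)
    have htk1 : (k : ℝ) + 1 ≤ t := by
      rw [ht] at htk ⊢
      have : k < V.card := by exact_mod_cast htk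
      exact_mod_cast this
    set β := ∑ v ∈ V, b v with hβ
    have hβt : β ≤ t := by
      calc β ≤ ∑ v ∈ V, (1 : ℝ) := Finset.sum_le_sum fun v hv => (hb v hv).2
        _ = t := by simp [ht]
    have hβt' : (1 - γ) * t ≤ β := by
      calc (1 - γ) * t = ∑ v ∈ V, (1 - γ) := by simp [ht]; ring
        _ ≤ β := Finset.sum_le_sum fun v hv => (hb v hv).1
    have hβ0 : 0 ≤ β := le_trans (mul_nonneg (by linarith) ht0.le) hβt'
    set s := β / (k * W) with hs
    have hs0 : 0 ≤ s := by positivity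
    have hsW : s * W * k = β := by rw [hs]; field_simp
    have hs1 : s ≤ 1 - γ := by
      rw [hs, div_le_iff₀ (by positivity)]
      have h1 : (1 - γ) * ((1 + k * γ) * t) ≤ (1 - γ) * (k * W) :=
        mul_le_mul_of_nonneg_left hkW (by linarith)
      have h2 : 1 ≤ (1 - γ) * (1 + k * γ) := by nlinarith
      have h3 : t ≤ (1 - γ) * (1 + k * γ) * t := by nlinarith
      linarith
    have hq : 1 + (bad.card : ℝ) ≤ s * W := by
      have hk0 : (0 : ℝ) < k := by linarith
      refine le_of_mul_le_mul_right ?_ hk0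
      rw [hsW]
      refine le_trans ?_ hβt'
      by_cases hat : a * t ≤ 1
      · rw [hb0 hat]
        simp only [Finset.card_empty, Nat.cast_zero, add_zero, one_mul]
        have h1 : γ * (k + 1) ≤ 1 := by nlinarith
        nlinarith
      · push Not at hat
        have hn : (n : ℝ) + 2 ≤ k := by
          have : n + 2 ≤ k := by omega
          exact_mod_cast this
        have h1 : 1 + (bad.card : ℝ) ≤ (n + 1) * (a * t) := by linarith
        have h2 : (n + 1) * (a * t) ≤ k * (a * t) :=
          mul_le_mul_of_nonneg_right (by linarith) (by linarith)
        have h3 : (1 + (bad.card : ℝ)) * k ≤ k * (a * t) * k :=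
          mul_le_mul_of_nonneg_right (by linarith) hk0.le
        have h4 : a * (2 * (k : ℝ) ^ 2) * t ≤ 1 * t := mul_le_mul_of_nonneg_right hac' ht0.le
        nlinarith
    have htr := sl_transport V S bad v1 hSV h1S y b (fun v => s * u v) (s * W) hbV hv1min
      (hgood hv1min) (fun v hv => (hb v hv).2) (fun v _ => mul_nonneg hs0 (hu0 v))
      (fun v hv => by
        have h1 : s * u v ≤ s * 1 := mul_le_mul_of_nonneg_left (hwv v) hs0
        have := (hb v hv).1
        linarith) hq (by
        rw [← Finset.mul_sum, husum]
        linarith)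
    refine le_trans ?_ htr
    have h5 : s * W * ∑ v ∈ S, y v + ∑ v ∈ V, s * u v * y v
        = s * (W * ∑ v ∈ S, y v + ∑ v ∈ V, u v * y v) := by
      rw [mul_add, Finset.mul_sum V]
      simp only [mul_assoc]
    rw [h5]
    exact mul_nonneg hs0 hmain
  obtain ⟨w, hw0, hwb⟩ := sl_farkas V (generatedEdges d E C) hHne b
    (fun v hv => ⟨by linarith [(hb v hv).1], (hb v hv).2⟩) key
  refine ⟨w, fun e he => ⟨hw0 e, ?_⟩, hwb⟩
  obtain ⟨v, hv⟩ := (hHne e he).2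
  have hvV := (hHne e he).1 hv
  refine le_trans ?_ (hb v hvV).2
  rw [← hwb v hvV]
  exact Finset.single_le_sum (f := w) (fun i _ => hw0 i) (by simp [he, hv])
end
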